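/- arXiv:1011.3833 — 8 statements merged into one kernel-verified Lean document; each statement's English description precedes it below -/
import Mathlib

section
/- Let a ≥ 4 be an integer. For every ε > 0 there exists N such that for all integers n ≥ N one has |γ³ + (6a−3)·γ·π²/6 + 2·ζ(3) − p_{n,3}/q_n| ≤ exp((a·(cos(2π/a) − 1) + ε)·n^{1−1/a}), where ζ(3) = ∑_{j≥1} 1/j³. -/
/-- Generalized harmonic number `H_n^{(m)} = ∑_{j=1}^n 1/j^m`. -/
noncomputable def genHarmonic (m n : ℕ) : ℚ :=
  ∑ j ∈ Finset.range n, (1 : ℚ) / ((j : ℚ) + 1) ^ m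

/-- `q_n = ∑_{k=0}^n C(n,k)^a · k!`. -/
noncomputable def qseq (a n : ℕ) : ℚ :=
  ∑ k ∈ Finset.range (n + 1), (n.choose k : ℚ) ^ a * (Nat.factorial k : ℚ)

/-- `r_1(k) = a·H_{n-k} - (a-1)·H_k`. -/
noncomputable def r1 (a n k : ℕ) : ℚ :=
  (a : ℚ) * harmonic (n - k) - ((a : ℚ) - 1) * harmonic k

/-- `r_2(k) = a·H_{n-k}^{(2)} + (a-1)·H_k^{(2)}`. -/
noncomputable def r2 (a n k : ℕ) : ℚ :=
  (a : ℚ) * genHarmonic 2 (n - k) + ((a : ℚ) - 1) * genHarmonic 2 k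

/-- `r_3(k) = 2·(a·H_{n-k}^{(3)} - (a-1)·H_k^{(3)})`. -/
noncomputable def r3 (a n k : ℕ) : ℚ :=
  2 * ((a : ℚ) * genHarmonic 3 (n - k) - ((a : ℚ) - 1) * genHarmonic 3 k)

/-- `p_{n,3} = ∑_{k=0}^n C(n,k)^a · k! · (r_1(k)³ + 3·r_1(k)·r_2(k) + r_3(k))`. -/
noncomputable def pseq3 (a n : ℕ) : ℚ :=
  ∑ k ∈ Finset.range (n + 1), (n.choose k : ℚ) ^ a * (Nat.factorial k : ℚ) *
    ((r1 a n k) ^ 3 + 3 * r1 a n k * r2 a n k + r3 a n k)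

section StirlingBound

open Real Filter Topology

/-- The real part of `z * log z - z` at `z = x + y * I` (for `0 ≤ x` and `0 ≤ y`). -/
noncomputable def stirlingExponent (x y : ℝ) : ℝ :=
  x / 2 * log (x ^ 2 + y ^ 2) + y * (arctan (x / y) - π / 2) - x

theorem hasDerivAt_stirlingExponent {x y : ℝ} (h : 0 < x ∨ 0 < y) :
    HasDerivAt (fun t => stirlingExponent t y) (log (x ^ 2 + y ^ 2) / 2) x := by
  have hpos : 0 < x ^ 2 + y ^ 2 := by rcases h with h | h <;> positivity
  have hd : HasDerivAt (fun t : ℝ => t / 2 * log (t ^ 2 + y ^ 2))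
      (1 / 2 * log (x ^ 2 + y ^ 2) + x / 2 * ((2 * x) / (x ^ 2 + y ^ 2))) x := by
    have h2 : HasDerivAt (fun t : ℝ => t ^ 2 + y ^ 2) (2 * x) x := by
      simpa using (hasDerivAt_pow 2 x).add_const (y ^ 2)
    exact ((hasDerivAt_id x).div_const 2).mul (h2.log hpos.ne')
  have ha : HasDerivAt (fun t : ℝ => y * (arctan (t / y) - π / 2))
      (y * (1 / (1 + (x / y) ^ 2) * (1 / y))) x :=
    ((((hasDerivAt_id x).div_const y).arctan).sub_const (π / 2)).const_mul y
  have := (hd.add ha).sub (hasDerivAt_id x)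
  refine this.congr_deriv ?_
  rcases eq_or_ne y 0 with rfl | hy
  · have hx : x ≠ 0 := by rintro rfl; simp at hpos
    field_simp
    ring
  · field_simp
    ring

theorem stirlingExponent_zero_right (x : ℝ) : stirlingExponent x 0 = x * log x - x := by
  simp [stirlingExponent, log_pow]; ring

theorem stirlingExponent_eq {x y : ℝ} (hx : 0 < x) (hy : 0 ≤ y) :
    stirlingExponent x y = x * log x - x + x / 2 * log (1 + (y / x) ^ 2) - y * arctan (y / x) := by
  have h1 : x ^ 2 + y ^ 2 = x ^ 2 * (1 + (y / x) ^ 2) := by field_simp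
  have h2 : y * (arctan (x / y) - π / 2) = - (y * arctan (y / x)) := by
    rcases hy.eq_or_lt with rfl | hy
    · simp
    · have := arctan_inv_of_pos (div_pos hy hx)
      rw [inv_div] at this
      rw [this]; ring
  rw [stirlingExponent, h1, h2, log_mul (by positivity) (by positivity), log_pow]
  push_cast; ring

/-- On a horizontal half-line `stirlingExponent` lies above its tangents. -/
theorem stirlingExponent_tangent_le {x c y : ℝ} (hx : 0 ≤ x) (hc : 0 ≤ c)
    (h : (0 < x ∧ 0 < c) ∨ 0 < y) :
    stirlingExponent c y + (x - c) * (log (c ^ 2 + y ^ 2) / 2) ≤ stirlingExponent x y := by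
  have hd : ∀ t, min x c ≤ t → HasDerivAt (fun t => stirlingExponent t y)
      (log (t ^ 2 + y ^ 2) / 2) t := fun t ht => hasDerivAt_stirlingExponent (by
    rcases h with ⟨h1, h2⟩ | h
    · exact Or.inl ((lt_min h1 h2).trans_le ht)
    · exact Or.inr h)
  have hp : ∀ t, min x c ≤ t → 0 < t ^ 2 + y ^ 2 := fun t ht => by
    rcases h with ⟨h1, h2⟩ | h
    · have := (lt_min h1 h2).trans_le ht
      positivity
    · positivity
  rcases lt_trichotomy x c with hxc | rfl | hxc
  · rw [min_eq_left hxc.le] at hd hp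
    obtain ⟨ξ, ⟨h1, h2⟩, h3⟩ := exists_hasDerivAt_eq_slope (fun t => stirlingExponent t y)
      (fun t => log (t ^ 2 + y ^ 2) / 2) hxc
      (fun t ht => (hd t ht.1).continuousAt.continuousWithinAt) (fun t ht => hd t ht.1.le)
    rw [eq_div_iff (by linarith)] at h3
    have : log (ξ ^ 2 + y ^ 2) ≤ log (c ^ 2 + y ^ 2) :=
      log_le_log (hp ξ h1.le) (by nlinarith)
    nlinarith
  · simp
  · rw [min_eq_right hxc.le] at hd hp
    obtain ⟨ξ, ⟨h1, h2⟩, h3⟩ := exists_hasDerivAt_eq_slope (fun t => stirlingExponent t y)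
      (fun t => log (t ^ 2 + y ^ 2) / 2) hxc
      (fun t ht => (hd t ht.1).continuousAt.continuousWithinAt) (fun t ht => hd t ht.1.le)
    rw [eq_div_iff (by linarith)] at h3
    have : log (c ^ 2 + y ^ 2) ≤ log (ξ ^ 2 + y ^ 2) :=
      log_le_log (hp c le_rfl) (by nlinarith)
    nlinarith

theorem half_log_one_add_sq_le_mul_arctan {t : ℝ} (ht : 0 ≤ t) :
    log (1 + t ^ 2) / 2 ≤ t * arctan t := by
  have hd : ∀ u : ℝ, HasDerivAt (fun u => u * arctan u - log (1 + u ^ 2) / 2) (arctan u) u := by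
    intro u
    have h2 : HasDerivAt (fun t : ℝ => 1 + t ^ 2) (2 * u) u := by
      simpa using (hasDerivAt_pow 2 u).const_add 1
    refine (((hasDerivAt_id u).mul (hasDerivAt_arctan u)).sub
      ((h2.log (by positivity)).div_const 2)).congr_deriv ?_
    simp only [id]
    field_simp
    ring
  have hm : MonotoneOn (fun u => u * arctan u - log (1 + u ^ 2) / 2) (Set.Ici 0) := by
    refine monotoneOn_of_deriv_nonneg (convex_Ici 0)
      (fun u _ => (hd u).continuousAt.continuousWithinAt)
      (fun u _ => (hd u).differentiableAt.differentiableWithinAt) fun u hu => ?_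
    rw [(hd u).deriv]
    rw [interior_Ici] at hu
    exact arctan_nonneg.2 (le_of_lt hu)
  have := hm (Set.mem_Ici.2 le_rfl) (Set.mem_Ici.2 ht) ht
  simp at this
  linarith

theorem stirlingExponent_le_real {x y : ℝ} (hx : 0 < x) (hy : 0 ≤ y) :
    stirlingExponent x y ≤ stirlingExponent x 0 := by
  rw [stirlingExponent_eq hx hy, stirlingExponent_zero_right]
  have h := half_log_one_add_sq_le_mul_arctan (div_nonneg hy hx.le)
  have h2 := mul_le_mul_of_nonneg_left h hx.le
  have h3 : x * (y / x * arctan (y / x)) = y * arctan (y / x) := by field_simp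
  linarith

theorem sub_le_stirlingExponent {x y : ℝ} (hx : 0 < x) (hy : 0 ≤ y) :
    x * log x - x - y * (π / 2) ≤ stirlingExponent x y := by
  rw [stirlingExponent_eq hx hy]
  have h1 : 0 ≤ log (1 + (y / x) ^ 2) := log_nonneg (by nlinarith [sq_nonneg (y / x)])
  have h2 := mul_le_mul_of_nonneg_left (arctan_lt_pi_div_two (y / x)).le hy
  have h3 := mul_nonneg hx.le h1
  linarith

theorem sub_sq_le_stirlingExponent {x y : ℝ} (hx : 0 < x) (hy : 0 ≤ y) :
    x * log x - x - y ^ 2 / x ≤ stirlingExponent x y := by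
  rw [stirlingExponent_eq hx hy]
  have h1 : 0 ≤ log (1 + (y / x) ^ 2) := log_nonneg (by nlinarith [sq_nonneg (y / x)])
  have h4 : arctan (y / x) ≤ y / x := by
    simpa using le_tan (arctan_nonneg.2 (div_nonneg hy hx.le)) (arctan_lt_pi_div_two (y / x))
  have h2 := mul_le_mul_of_nonneg_left h4 hy
  have h3 := mul_nonneg hx.le h1
  have : y * (y / x) = y ^ 2 / x := by ring
  linarith

theorem exp_mul_log_sub_le_Gamma {x : ℝ} (hx : 0 < x) : exp (x * log x - x) ≤ Gamma (x + 1) := by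
  rw [Gamma_eq_integral (by linarith)]
  have hi := GammaIntegral_convergent (s := x + 1) (by linarith)
  have h1 : ∫ t in Set.Ioi x, exp (-t) * x ^ x = exp (x * log x - x) := by
    rw [MeasureTheory.integral_mul_const, integral_exp_neg_Ioi, rpow_def_of_pos hx, ← exp_add]
    ring_nf
  rw [← h1]
  have hsub : Set.Ioi x ⊆ Set.Ioi 0 := Set.Ioi_subset_Ioi hx.le
  calc _ ≤ ∫ t in Set.Ioi x, exp (-t) * t ^ (x + 1 - 1) := by
        refine MeasureTheory.setIntegral_mono_on ?_ (hi.mono_set hsub) measurableSet_Ioi ?_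
        · exact (integrableOn_exp_neg_Ioi x).mul_const _
        · intro t ht
          rw [add_sub_cancel_right]
          gcongr
          exact le_of_lt ht
    _ ≤ _ := by
        refine MeasureTheory.setIntegral_mono_set hi ?_ (Filter.Eventually.of_forall hsub)
        filter_upwards [MeasureTheory.ae_restrict_mem measurableSet_Ioi] with t ht
        have : (0:ℝ) < t := ht
        positivity

theorem prod_norm_add_le {x y : ℝ} (hx : 0 < x) (hy : 0 ≤ y) (k : ℕ) :
    ∏ j ∈ Finset.range k, ‖((x : ℂ) + 1 + y * Complex.I) + j‖ ≤
      (∏ j ∈ Finset.range k, (x + 1 + j)) * exp ((stirlingExponent x 0 - stirlingExponent x y) -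
        (stirlingExponent (x + k) 0 - stirlingExponent (x + k) y)) := by
  induction k with
  | zero => simp
  | succ k ih =>
    rw [Finset.prod_range_succ, Finset.prod_range_succ]
    set u : ℝ := x + k with hu
    have hu0 : 0 < u := by positivity
    have hn : ‖((x : ℂ) + 1 + y * Complex.I) + k‖ = exp (log ((u + 1) ^ 2 + y ^ 2) / 2) := by
      have : ((x : ℂ) + 1 + y * Complex.I) + k = ((u + 1 : ℝ) : ℂ) + y * Complex.I := by
        rw [hu]; push_cast; ring
      rw [this, Complex.norm_add_mul_I, sqrt_eq_rpow, rpow_def_of_pos (by positivity)]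
      ring_nf
    have hstep : log ((u + 1) ^ 2 + y ^ 2) / 2 ≤ log (u + 1) +
        ((stirlingExponent u 0 - stirlingExponent u y) -
          (stirlingExponent (u + 1) 0 - stirlingExponent (u + 1) y)) := by
      have hd : ∀ t, u ≤ t → HasDerivAt (fun t => stirlingExponent t 0 - stirlingExponent t y)
          (log (t ^ 2 + 0 ^ 2) / 2 - log (t ^ 2 + y ^ 2) / 2) t := fun t ht =>
        (hasDerivAt_stirlingExponent (Or.inl (by linarith))).sub
          (hasDerivAt_stirlingExponent (Or.inl (by linarith)))
      obtain ⟨ξ, ⟨h1, h2⟩, h3⟩ := exists_hasDerivAt_eq_slope _ _ (lt_add_one u)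
        (fun t ht => (hd t ht.1).continuousAt.continuousWithinAt) (fun t ht => hd t ht.1.le)
      have hξ : 0 < ξ := by linarith
      have e1 : ∀ t : ℝ, 0 < t → log (t ^ 2 + y ^ 2) = log (t ^ 2 + 0 ^ 2) +
          log (1 + (y / t) ^ 2) := fun t ht => by
        rw [← log_mul (by positivity) (by positivity)]
        congr 1
        field_simp
        ring
      have e2 : log (1 + (y / (u + 1)) ^ 2) ≤ log (1 + (y / ξ) ^ 2) := by
        gcongr
      have e3 : log ((u + 1) ^ 2 + 0 ^ 2) = 2 * log (u + 1) := by simp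
      have e4 := e1 ξ hξ
      have e5 := e1 (u + 1) (by linarith)
      rw [add_sub_cancel_left, div_one] at h3
      have e6 : log ((u + 1) ^ 2 + y ^ 2) / 2 - log (u + 1) ≤
          log (ξ ^ 2 + y ^ 2) / 2 - log (ξ ^ 2 + 0 ^ 2) / 2 := by
        rw [e4, e5, e3]
        linarith
      linarith
    have hx1 : x + 1 + (k : ℝ) = exp (log (u + 1)) := by
      rw [exp_log (by positivity), hu]; ring
    have hk : x + ((k + 1 : ℕ) : ℝ) = u + 1 := by rw [hu]; push_cast; ring
    rw [hn, hx1, hk]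
    calc _ ≤ ((∏ j ∈ Finset.range k, (x + 1 + j)) *
          exp ((stirlingExponent x 0 - stirlingExponent x y) -
            (stirlingExponent u 0 - stirlingExponent u y))) *
          exp (log (u + 1) + ((stirlingExponent u 0 - stirlingExponent u y) -
          (stirlingExponent (u + 1) 0 - stirlingExponent (u + 1) y))) := by
          gcongr
      _ = _ := by
          rw [mul_assoc, mul_assoc, ← exp_add, ← exp_add]
          ring_nf

theorem exp_stirlingExponent_le_norm_Gamma {x y : ℝ} (hx : 0 < x) (hy : 0 ≤ y) :
    exp (stirlingExponent x y) ≤ ‖Complex.Gamma ((x : ℂ) + 1 + y * Complex.I)‖ := by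
  have hD : exp (stirlingExponent x y) ≤
      Gamma (x + 1) * exp (-(stirlingExponent x 0 - stirlingExponent x y)) := by
    refine le_trans (le_of_eq ?_) (mul_le_mul_of_nonneg_right
      (exp_mul_log_sub_le_Gamma hx) (exp_pos _).le)
    rw [← exp_add, stirlingExponent_zero_right]
    ring_nf
  refine hD.trans (le_of_tendsto_of_tendsto
    ((GammaSeq_tendsto_Gamma (x + 1)).mul_const _)
    (Complex.GammaSeq_tendsto_Gamma ((x : ℂ) + 1 + y * Complex.I)).norm ?_)
  filter_upwards [eventually_gt_atTop 0] with k hk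
  rw [GammaSeq, Complex.GammaSeq, norm_div, norm_mul, norm_prod,
    Complex.norm_natCast_cpow_of_pos hk, Complex.norm_natCast]
  have hre : ((x : ℂ) + 1 + y * Complex.I).re = x + 1 := by simp
  rw [hre]
  have hp : 0 < ∏ j ∈ Finset.range (k + 1), (x + 1 + (j : ℝ)) :=
    Finset.prod_pos fun j _ => by positivity
  have hq : 0 < ∏ j ∈ Finset.range (k + 1), ‖((x : ℂ) + 1 + y * Complex.I) + j‖ :=
    Finset.prod_pos fun j _ => by
      rw [norm_pos_iff]
      intro h
      have := congrArg Complex.re h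
      simp at this
      have : (0:ℝ) ≤ j := j.cast_nonneg
      linarith
  rw [div_mul_eq_mul_div, div_le_div_iff₀ hp hq, mul_assoc _ (exp _)]
  gcongr
  have := prod_norm_add_le hx hy (k + 1)
  have h0 := stirlingExponent_le_real (x := x + (k + 1 : ℕ)) (by positivity) hy
  calc _ ≤ exp (-(stirlingExponent x 0 - stirlingExponent x y)) *
      ((∏ j ∈ Finset.range (k + 1), (x + 1 + j)) *
        exp (stirlingExponent x 0 - stirlingExponent x y)) := by
        refine mul_le_mul_of_nonneg_left (this.trans ?_) (exp_pos _).le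
        refine mul_le_mul_of_nonneg_left (exp_le_exp.2 ?_) hp.le
        linarith
    _ = _ := by
        rw [mul_comm, mul_assoc, ← exp_add]; simp

end StirlingBound

section ContourFormula

open Complex MeasureTheory Filter Topology intervalIntegral
open scoped Real Interval

/-- The function `1 / (exp (-(2 * π * I * z)) - 1)`: it has period `1` and its poles are the integers. -/
noncomputable def integerPoleKernel (z : ℂ) : ℂ := (cexp (-(2 * π * I * z)) - 1)⁻¹

theorem exp_neg_two_pi_I_mul_eq_one {w : ℂ} (h : cexp (-(2 * π * I * w)) = 1) :
    ∃ n : ℤ, w = n := by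
  obtain ⟨n, hn⟩ := Complex.exp_eq_one_iff.1 h
  refine ⟨-n, ?_⟩
  have h2 : (2 * π * I : ℂ) ≠ 0 := Complex.two_pi_I_ne_zero
  apply mul_left_cancel₀ h2
  push_cast
  linear_combination -hn

theorem norm_exp_neg_two_pi_I_mul (w : ℂ) :
    ‖cexp (-(2 * π * I * w))‖ = Real.exp (2 * π * w.im) := by
  rw [Complex.norm_exp]; simp

theorem integerPoleKernel_add_one (z : ℂ) : integerPoleKernel (z + 1) = integerPoleKernel z := by
  have : cexp (-(2 * π * I * (z + 1))) = cexp (-(2 * π * I * z)) := by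
    rw [show -(2 * π * I * (z + 1)) = -(2 * π * I * z) - 2 * π * I by ring,
      Complex.exp_sub, Complex.exp_two_pi_mul_I, div_one]
  simp [integerPoleKernel, this]

theorem integral_inv_one_sub_mul_exp {q : ℂ} (hq : ‖q‖ < 1) :
    ∫ x : ℝ in (-1 / 2 : ℝ)..(1 / 2), (1 - q * cexp (2 * π * I * x))⁻¹ = 1 := by
  have hne : ∀ z ∈ Metric.closedBall (0 : ℂ) |1|, 1 - q * z ≠ 0 := by
    intro z hz h
    have hz' : ‖z‖ ≤ 1 := by simpa using hz
    have : ‖q * z‖ = 1 := by rw [← sub_eq_zero.1 h]; simp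
    rw [norm_mul] at this
    nlinarith [norm_nonneg q, norm_nonneg z]
  have hdiff : DiffContOnCl ℂ (fun z : ℂ => (1 - q * z)⁻¹) (Metric.ball 0 |1|) := by
    refine DifferentiableOn.diffContOnCl fun z hz => ?_
    have := hne z (Metric.closure_ball_subset_closedBall hz)
    have hd : DifferentiableAt ℂ (fun z : ℂ => 1 - q * z) z := by fun_prop
    exact (hd.inv this).differentiableWithinAt
  have hmean := hdiff.circleAverage
  rw [Real.circleAverage] at hmean
  simp only [circleMap, mul_zero, sub_zero, inv_one, zero_add, ofReal_one, one_mul] at hmean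
  have hper : Function.Periodic (fun x : ℝ => (1 - q * cexp (2 * π * I * x))⁻¹) 1 := by
    intro x
    have : cexp (2 * π * I * ((x + 1 : ℝ) : ℂ)) = cexp (2 * π * I * x) := by
      push_cast
      rw [mul_add, mul_one, Complex.exp_add, Complex.exp_two_pi_mul_I, mul_one]
    simp only [this]
  have h1 := hper.intervalIntegral_add_eq (-1 / 2) 0
  rw [show (-1 / 2 : ℝ) + 1 = 1 / 2 by norm_num, zero_add] at h1
  rw [h1]
  have h2 := intervalIntegral.integral_comp_mul_left (a := 0) (b := 1)
    (fun θ : ℝ => (1 - q * cexp (θ * I))⁻¹) (c := 2 * Real.pi) (by positivity)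
  rw [mul_zero, mul_one, hmean] at h2
  have h3 : ∫ x : ℝ in (0 : ℝ)..1, (1 - q * cexp (2 * π * I * x))⁻¹ =
      ∫ x : ℝ in (0 : ℝ)..1, (1 - q * cexp (((2 * π * x : ℝ) : ℂ) * I))⁻¹ := by
    refine intervalIntegral.integral_congr fun x _ => ?_
    have : 2 * π * I * x = ((2 * π * x : ℝ) : ℂ) * I := by push_cast; ring
    simp only [this]
  exact h3.trans h2

theorem integral_integerPoleKernel_upper {s : ℂ} {Y : ℝ} (h : s.im < Y) :
    ∫ x : ℝ in (-1 / 2 : ℝ)..(1 / 2), integerPoleKernel (x + Y * I - s) = 0 := by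
  set q : ℂ := cexp (2 * π * I * (Y * I - s)) with hq
  have hq1 : ‖q‖ < 1 := by
    rw [hq, Complex.norm_exp, Real.exp_lt_one_iff]
    have : 0 < 2 * π * (Y - s.im) := by have := Real.pi_pos; have := sub_pos.2 h; positivity
    simp
    linarith
  have hne : ∀ x : ℝ, 1 - q * cexp (2 * π * I * x) ≠ 0 := by
    intro x h
    have h1 : ‖q * cexp (2 * π * I * x)‖ = 1 := by rw [← sub_eq_zero.1 h]; simp
    rw [norm_mul, Complex.norm_exp (2 * π * I * x)] at h1
    simp at h1
    linarith
  have key : ∀ x : ℝ, integerPoleKernel (x + Y * I - s) =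
      (1 - q * cexp (2 * π * I * x))⁻¹ - 1 := by
    intro x
    have h1 : cexp (-(2 * π * I * (x + Y * I - s))) = (q * cexp (2 * π * I * x))⁻¹ := by
      rw [hq, ← Complex.exp_add, ← Complex.exp_neg]; ring_nf
    have h0 : q * cexp (2 * π * I * x) ≠ 0 := mul_ne_zero (Complex.exp_ne_zero _) (Complex.exp_ne_zero _)
    rw [integerPoleKernel, h1]
    have := hne x
    generalize q * cexp (2 * π * I * x) = t at *
    have h3 : t⁻¹ - 1 = (1 - t) / t := by field_simp
    rw [h3]
    field_simp
    ring
  simp_rw [key]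
  rw [intervalIntegral.integral_sub, integral_inv_one_sub_mul_exp hq1]
  · norm_num
  · exact (Continuous.inv₀ (by fun_prop) hne).intervalIntegrable _ _
  · simp

theorem integral_integerPoleKernel_lower {s : ℂ} {Y : ℝ} (h : Y < s.im) :
    ∫ x : ℝ in (-1 / 2 : ℝ)..(1 / 2), integerPoleKernel (x + Y * I - s) = -1 := by
  set q : ℂ := cexp (-(2 * π * I * (Y * I - s))) with hq
  have hq1 : ‖q‖ < 1 := by
    rw [hq, Complex.norm_exp, Real.exp_lt_one_iff]
    have : 0 < 2 * π * (s.im - Y) := by have := Real.pi_pos; have := sub_pos.2 h; positivity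
    simp
    linarith
  have key : ∀ x : ℝ, integerPoleKernel (x + Y * I - s) =
      -(1 - q * cexp (2 * π * I * (-x : ℝ)))⁻¹ := by
    intro x
    have h1 : cexp (-(2 * π * I * (x + Y * I - s))) = (q * cexp (2 * π * I * (-x : ℝ))) := by
      rw [hq, ← Complex.exp_add]; push_cast; ring_nf
    rw [integerPoleKernel, h1, ← inv_neg, neg_sub]
  simp_rw [key]
  rw [intervalIntegral.integral_neg, intervalIntegral.integral_comp_neg
    (fun x : ℝ => (1 - q * cexp (2 * π * I * x))⁻¹)]
  rw [show -(1 / 2 : ℝ) = -1 / 2 by norm_num, show -(-1 / 2 : ℝ) = 1 / 2 by norm_num,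
    integral_inv_one_sub_mul_exp hq1]

theorem continuous_integerPoleKernel_comp {γ : ℝ → ℂ} (hγ : Continuous γ)
    (h : ∀ t (n : ℤ), γ t ≠ n) : Continuous fun t => integerPoleKernel (γ t) := by
  refine Continuous.inv₀ (by fun_prop) fun t ht => ?_
  obtain ⟨n, hn⟩ := exp_neg_two_pi_I_mul_eq_one (sub_eq_zero.1 ht)
  exact h t n hn

theorem horizontal_ne_int {s : ℂ} {Y : ℝ} (h : Y ≠ s.im) (t : ℝ) (n : ℤ) :
    (t + Y * I - s : ℂ) ≠ n := by
  intro h1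
  have := congrArg Complex.im h1
  simp at this
  exact h (by linarith)

theorem vertical_ne_int {s : ℂ} (hs : ‖s‖ ≤ 1 / 4) (t : ℝ) (n : ℤ) :
    ((1 / 2 : ℝ) + t * I - s : ℂ) ≠ n := by
  intro h1
  have h2 := congrArg Complex.re h1
  simp at h2
  have h3 := abs_le.1 ((Complex.abs_re_le_norm s).trans hs)
  have h4 : (0:ℝ) < n := by linarith
  have h5 : (n:ℝ) < 1 := by linarith
  have h6 : 0 < n := by exact_mod_cast h4
  have h7 : n < 1 := by exact_mod_cast h5
  omega

theorem eq_boundary_integral {f : ℂ → ℂ} (hf : Differentiable ℂ f) {s : ℂ} (hs : ‖s‖ ≤ 1 / 4)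
    {Y : ℝ} (hY : 1 ≤ Y) :
    f s = (∫ x : ℝ in (-1 / 2 : ℝ)..(1 / 2), f (x + Y * I) * integerPoleKernel (x + Y * I - s)) -
      (∫ x : ℝ in (-1 / 2 : ℝ)..(1 / 2),
        f (x + (-Y : ℝ) * I) * integerPoleKernel (x + (-Y : ℝ) * I - s)) -
      I * ∫ y : ℝ in (-Y)..Y, (f ((1 / 2 : ℝ) + y * I) - f ((-1 / 2 : ℝ) + y * I)) *
        integerPoleKernel ((1 / 2 : ℝ) + y * I - s) := by
  have hsre := abs_le.1 ((Complex.abs_re_le_norm s).trans hs)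
  have hsim := abs_le.1 ((Complex.abs_im_le_norm s).trans hs)
  set E : ℂ → ℂ := fun w => cexp (-(2 * π * I * w)) with hE
  have hEd : Differentiable ℂ E := by fun_prop
  have hE0 : E 0 = 1 := by simp [hE]
  have hEderiv : deriv E 0 = -(2 * π * I) := by
    have : HasDerivAt E (cexp (-(2 * π * I * 0)) * -(2 * π * I * 1)) 0 :=
      (((hasDerivAt_id (0:ℂ)).const_mul (2 * π * I)).neg).cexp
    rw [this.deriv]; simp
  have hds : ∀ (g : ℂ → ℂ) (c : ℂ), Differentiable ℂ g → Differentiable ℂ (dslope g c) := by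
    intro g c hg
    rw [← differentiableOn_univ]
    exact (Complex.differentiableOn_dslope univ_mem).2 hg.differentiableOn
  set Φ : ℂ → ℂ := fun z => dslope f s z * (dslope E 0 (z - s))⁻¹ with hΦ
  have hΦeq : ∀ z, z ≠ s → Φ z = (f z - f s) * integerPoleKernel (z - s) := by
    intro z hz
    have hz' : z - s ≠ 0 := sub_ne_zero.2 hz
    simp only [hΦ]
    rw [dslope_of_ne _ hz, dslope_of_ne _ hz', slope_def_field, slope_def_field, hE0, sub_zero,
      show integerPoleKernel (z - s) = (E (z - s) - 1)⁻¹ from rfl, inv_div]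
    field_simp
  have hΦd : DifferentiableOn ℂ Φ
      ([[((-1 / 2 : ℝ) + (-Y : ℝ) * I : ℂ).re, ((1 / 2 : ℝ) + Y * I : ℂ).re]] ×ℂ
        [[((-1 / 2 : ℝ) + (-Y : ℝ) * I : ℂ).im, ((1 / 2 : ℝ) + Y * I : ℂ).im]]) := by
    intro z hz
    have hzre : z.re ∈ Set.Icc (-1 / 2 : ℝ) (1 / 2) := by
      have := hz.1
      simp only [Set.mem_preimage, add_re, ofReal_re, mul_re, I_re, I_im, ofReal_im,
        mul_zero, sub_zero, add_zero, mul_one] at this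
      rwa [Set.uIcc_of_le (by norm_num)] at this
    refine DifferentiableAt.differentiableWithinAt ?_
    refine (hds f s hf z).mul (DifferentiableAt.inv ?_ ?_)
    · exact (hds E 0 hEd (z - s)).comp z (by fun_prop)
    · by_cases hzs : z = s
      · rw [hzs, sub_self, dslope_same, hEderiv]
        exact neg_ne_zero.2 Complex.two_pi_I_ne_zero
      · have hz' : z - s ≠ 0 := sub_ne_zero.2 hzs
        rw [dslope_of_ne _ hz', slope_def_field, hE0, sub_zero]
        refine div_ne_zero (fun h0 => ?_) hz'
        obtain ⟨n, hn⟩ := exp_neg_two_pi_I_mul_eq_one (sub_eq_zero.1 h0)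
        have h2 := congrArg Complex.re hn
        simp at h2
        have h4 : (-1:ℝ) < n := by linarith [hzre.1]
        have h5 : (n:ℝ) < 1 := by linarith [hzre.2]
        have h6 : -1 < n := by exact_mod_cast h4
        have h7 : n < 1 := by exact_mod_cast h5
        have h8 : n = 0 := by omega
        rw [h8] at hn
        exact hz' (by simpa using hn)
  have hmain := Complex.integral_boundary_rect_eq_zero_of_differentiableOn Φ _ _ hΦd
  simp only [add_re, ofReal_re, mul_re, I_re, I_im, ofReal_im, add_im, mul_im,
    mul_zero, sub_zero, add_zero, mul_one, zero_add, smul_eq_mul] at hmain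
  have hY1 : s.im < Y := by linarith
  have hY2 : -Y < s.im := by linarith
  have hcf : Continuous f := hf.continuous
  have horiz : ∀ Y' : ℝ, Y' ≠ s.im → ∫ x : ℝ in (-1 / 2 : ℝ)..(1 / 2), Φ (x + Y' * I) =
      (∫ x : ℝ in (-1 / 2 : ℝ)..(1 / 2), f (x + Y' * I) * integerPoleKernel (x + Y' * I - s)) -
      f s * ∫ x : ℝ in (-1 / 2 : ℝ)..(1 / 2), integerPoleKernel (x + Y' * I - s) := by
    intro Y' hY'
    have hc : Continuous fun x : ℝ => integerPoleKernel (x + Y' * I - s) :=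
      continuous_integerPoleKernel_comp (by fun_prop) (horizontal_ne_int hY')
    rw [← intervalIntegral.integral_const_mul, ← intervalIntegral.integral_sub]
    · refine intervalIntegral.integral_congr fun x _ => ?_
      rw [hΦeq _ fun h => ?_, sub_mul]
      have := congrArg Complex.im h
      simp at this
      exact hY' this
    · exact (by fun_prop : Continuous _).intervalIntegrable _ _
    · exact (by fun_prop : Continuous _).intervalIntegrable _ _
  have hper : ∀ y : ℝ, integerPoleKernel ((-1 / 2 : ℝ) + y * I - s) =
      integerPoleKernel ((1 / 2 : ℝ) + y * I - s) := by
    intro y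
    rw [← integerPoleKernel_add_one]
    congr 1
    push_cast; ring
  have hcv : Continuous fun y : ℝ => integerPoleKernel ((1 / 2 : ℝ) + y * I - s) :=
    continuous_integerPoleKernel_comp (by fun_prop) (vertical_ne_int hs)
  have hvert : (∫ y : ℝ in (-Y)..Y, Φ ((1 / 2 : ℝ) + y * I)) -
      (∫ y : ℝ in (-Y)..Y, Φ ((-1 / 2 : ℝ) + y * I)) =
      ∫ y : ℝ in (-Y)..Y, (f ((1 / 2 : ℝ) + y * I) - f ((-1 / 2 : ℝ) + y * I)) *
        integerPoleKernel ((1 / 2 : ℝ) + y * I - s) := by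
    have e1 : ∀ y : ℝ, Φ ((1 / 2 : ℝ) + y * I) = (f ((1 / 2 : ℝ) + y * I) - f s) *
        integerPoleKernel ((1 / 2 : ℝ) + y * I - s) := fun y => hΦeq _ fun h => by
      have := congrArg Complex.re h
      simp at this
      linarith
    have e2 : ∀ y : ℝ, Φ ((-1 / 2 : ℝ) + y * I) = (f ((-1 / 2 : ℝ) + y * I) - f s) *
        integerPoleKernel ((1 / 2 : ℝ) + y * I - s) := fun y => by
      rw [← hper]
      refine hΦeq _ fun h => ?_
      have := congrArg Complex.re h
      simp at this
      linarith
    simp_rw [e1, e2]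
    rw [← intervalIntegral.integral_sub]
    · refine intervalIntegral.integral_congr fun x _ => ?_
      ring
    · exact (by fun_prop : Continuous _).intervalIntegrable _ _
    · exact (by fun_prop : Continuous _).intervalIntegrable _ _
  rw [horiz Y hY1.ne', horiz (-Y) hY2.ne, integral_integerPoleKernel_upper hY1,
    integral_integerPoleKernel_lower hY2] at hmain
  rw [← hvert]
  linear_combination hmain

theorem one_le_two_mul_norm_sub_one {E : ℂ} (h : E.re ≤ 0 ∨ 2 ≤ ‖E‖ ∨ ‖E‖ ≤ 1 / 2) :
    1 ≤ 2 * ‖E - 1‖ ∧ ‖E‖ ≤ 2 * ‖E - 1‖ := by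
  have h1 : ‖E‖ - 1 ≤ ‖E - 1‖ := by simpa using norm_sub_norm_le E 1
  have h2 : 1 - ‖E‖ ≤ ‖E - 1‖ := by
    rw [norm_sub_rev]; simpa using norm_sub_norm_le 1 E
  rcases h with h | h | h
  · have h3 : 1 ≤ ‖E - 1‖ := by
      have := Complex.abs_re_le_norm (E - 1)
      rw [sub_re, one_re, abs_of_nonpos (by linarith)] at this
      linarith
    constructor <;> linarith
  · constructor <;> linarith
  · constructor <;> linarith

theorem norm_integerPoleKernel_sub_le {s z : ℂ} (hs : ‖s‖ ≤ 1 / 4)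
    (hz : z.re = 1 / 2 ∨ 1 ≤ |z.im|) :
    ‖integerPoleKernel (z - s) - integerPoleKernel z‖ ≤
      4 * (1 + Real.exp 2) * Real.exp 2 * Real.exp (-(2 * π * |z.im|)) := by
  have hsre := abs_le.1 ((Complex.abs_re_le_norm s).trans hs)
  have hsim := abs_le.1 ((Complex.abs_im_le_norm s).trans hs)
  have hpi := Real.pi_le_four
  have hpi3 := Real.pi_gt_three
  set E := cexp (-(2 * π * I * z)) with hE
  set σ := cexp (2 * π * I * s) with hσ
  have hEn : ‖E‖ = Real.exp (2 * π * z.im) := norm_exp_neg_two_pi_I_mul z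
  have hσn : ‖σ‖ = Real.exp (-(2 * π * s.im)) := by
    rw [hσ, Complex.norm_exp]; simp
  have hEσ : cexp (-(2 * π * I * (z - s))) = E * σ := by
    rw [hE, hσ, ← Complex.exp_add]; ring_nf
  have hσ1 : ‖σ‖ ≤ Real.exp 2 := by rw [hσn]; gcongr; nlinarith
  have hσ2 : Real.exp (-2) ≤ ‖σ‖ := by rw [hσn]; gcongr; nlinarith
  have h2 : (2:ℝ) ≤ Real.exp 1 := by linarith [Real.add_one_le_exp 1]
  have h2' : Real.exp (-1) ≤ 1 / 2 := by
    rw [Real.exp_neg, one_div]; exact inv_anti₀ (by norm_num) h2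
  have hcase : (E.re ≤ 0 ∨ 2 ≤ ‖E‖ ∨ ‖E‖ ≤ 1 / 2) ∧
      ((E * σ).re ≤ 0 ∨ 2 ≤ ‖E * σ‖ ∨ ‖E * σ‖ ≤ 1 / 2) := by
    have hEσn : ‖E * σ‖ = Real.exp (2 * π * z.im - 2 * π * s.im) := by
      rw [norm_mul, hEn, hσn, ← Real.exp_add]; ring_nf
    rcases hz with hz | hz
    · refine ⟨Or.inl ?_, Or.inl ?_⟩
      · rw [hE, Complex.exp_re]
        refine mul_nonpos_of_nonneg_of_nonpos (Real.exp_pos _).le ?_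
        simp only [neg_im, mul_im, mul_re, ofReal_re, ofReal_im, I_re, I_im, re_ofNat, im_ofNat]
        rw [hz]
        ring_nf
        simp
      · rw [← hEσ, Complex.exp_re]
        refine mul_nonpos_of_nonneg_of_nonpos (Real.exp_pos _).le ?_
        have : (-(2 * π * I * (z - s))).im = 2 * π * s.re - π := by
          simp [hz]; ring
        rw [this, Real.cos_sub_pi]
        have := Real.cos_nonneg_of_mem_Icc (x := 2 * π * s.re) ⟨by nlinarith, by nlinarith⟩
        linarith
    · rcases le_abs'.1 hz with hz | hz
      · refine ⟨Or.inr (Or.inr ?_), Or.inr (Or.inr ?_)⟩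
        · rw [hEn]; refine le_trans (Real.exp_le_exp.2 ?_) h2'; nlinarith
        · rw [hEσn]; refine le_trans (Real.exp_le_exp.2 ?_) h2'; nlinarith
      · refine ⟨Or.inr (Or.inl ?_), Or.inr (Or.inl ?_)⟩
        · rw [hEn]; refine le_trans h2 (Real.exp_le_exp.2 ?_); nlinarith
        · rw [hEσn]; refine le_trans h2 (Real.exp_le_exp.2 ?_); nlinarith
  obtain ⟨a1, a2⟩ := one_le_two_mul_norm_sub_one hcase.1
  obtain ⟨b1, b2⟩ := one_le_two_mul_norm_sub_one hcase.2
  have hA : 0 < ‖E - 1‖ := by linarith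
  have hB : 0 < ‖E * σ - 1‖ := by linarith
  have hA' : E - 1 ≠ 0 := norm_pos_iff.1 hA
  have hB' : E * σ - 1 ≠ 0 := norm_pos_iff.1 hB
  have hdiff : integerPoleKernel (z - s) - integerPoleKernel z =
      E * (1 - σ) / ((E - 1) * (E * σ - 1)) := by
    rw [integerPoleKernel, integerPoleKernel, hEσ, ← hE]
    field_simp
    ring
  rw [hdiff, norm_div, norm_mul, norm_mul, div_le_iff₀ (by positivity)]
  have h1σ : ‖1 - σ‖ ≤ 1 + Real.exp 2 :=
    (norm_sub_le _ _).trans (by simpa using hσ1)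
  rw [norm_mul] at b2
  have hE0 : 0 < ‖E‖ := by rw [hEn]; exact Real.exp_pos _
  have hmin : ‖E‖ ≤ 4 * Real.exp 2 * Real.exp (-(2 * π * |z.im|)) * (‖E - 1‖ * ‖E * σ - 1‖) := by
    have hx := Real.exp_pos 2
    have hx1 : 1 ≤ Real.exp 2 := Real.one_le_exp (by norm_num)
    rcases le_total 0 z.im with h0 | h0
    · rw [abs_of_nonneg h0, Real.exp_neg, ← hEn]
      have hc : ‖E‖ ≤ Real.exp 2 * (2 * ‖E * σ - 1‖) := by
        have : Real.exp 2 * Real.exp (-2) = 1 := by rw [← Real.exp_add]; simp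
        calc ‖E‖ = Real.exp 2 * (‖E‖ * Real.exp (-2)) := by linear_combination (-‖E‖) * this
          _ ≤ Real.exp 2 * (‖E‖ * ‖σ‖) := by gcongr
          _ ≤ _ := by gcongr
      have : ‖E‖ * ‖E‖ ≤ (2 * ‖E - 1‖) * (Real.exp 2 * (2 * ‖E * σ - 1‖)) := by gcongr
      calc ‖E‖ = (‖E‖ * ‖E‖) * ‖E‖⁻¹ := by field_simp
        _ ≤ ((2 * ‖E - 1‖) * (Real.exp 2 * (2 * ‖E * σ - 1‖))) * ‖E‖⁻¹ := by gcongr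
        _ = _ := by ring
    · rw [abs_of_nonpos h0, mul_neg, neg_neg, ← hEn]
      have : 1 * 1 ≤ (2 * ‖E - 1‖) * (2 * ‖E * σ - 1‖) := by gcongr
      calc ‖E‖ = 1 * ‖E‖ * (1 * 1) := by ring
        _ ≤ Real.exp 2 * ‖E‖ * ((2 * ‖E - 1‖) * (2 * ‖E * σ - 1‖)) := by gcongr
        _ = _ := by ring
  calc ‖E‖ * ‖1 - σ‖ ≤ (4 * Real.exp 2 * Real.exp (-(2 * π * |z.im|)) *
      (‖E - 1‖ * ‖E * σ - 1‖)) * (1 + Real.exp 2) := by gcongr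
    _ = _ := by ring

/-- An entire function whose values on the vertical lines `Re z = ±1/2` nearly agree is nearly
constant close to `0`. -/
theorem norm_sub_apply_zero_le {f : ℂ → ℂ} (hf : Differentiable ℂ f) {s : ℂ} (hs : ‖s‖ ≤ 1 / 4)
    {Y M : ℝ} (hY : 1 ≤ Y)
    (hhor : ∀ x y : ℝ, |x| ≤ 1 / 2 → |y| = Y → ‖f (x + y * I)‖ ≤ M * Real.exp (2 * π * Y))
    (hver : ∀ y : ℝ, |y| ≤ Y → ‖f ((1 / 2 : ℝ) + y * I) - f ((-1 / 2 : ℝ) + y * I)‖ ≤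
      M * Real.exp (2 * π * |y|)) :
    ‖f s - f 0‖ ≤ 4 * (1 + Real.exp 2) * Real.exp 2 * (2 + 2 * Y) * M := by
  set C := 4 * (1 + Real.exp 2) * Real.exp 2 with hC
  have hC0 : 0 < C := by positivity
  have hM : 0 ≤ M := by
    have := (norm_nonneg _).trans (hhor 0 Y (by norm_num) (abs_of_nonneg (by linarith)))
    exact nonneg_of_mul_nonneg_left this (Real.exp_pos _)
  have hsim := abs_le.1 ((Complex.abs_im_le_norm s).trans hs)
  have h0 : ‖(0:ℂ)‖ ≤ 1 / 4 := by norm_num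
  have hcf : Continuous f := hf.continuous
  have hhc : ∀ (s : ℂ) (Y' : ℝ), Y' ≠ s.im →
      Continuous fun x : ℝ => integerPoleKernel (x + Y' * I - s) := fun s Y' h =>
    continuous_integerPoleKernel_comp (by fun_prop) (horizontal_ne_int h)
  have hvc : ∀ s : ℂ, ‖s‖ ≤ 1 / 4 →
      Continuous fun y : ℝ => integerPoleKernel ((1 / 2 : ℝ) + y * I - s) := fun s h =>
    continuous_integerPoleKernel_comp (by fun_prop) (vertical_ne_int h)
  have hh : ∀ Y' : ℝ, |Y'| = Y →
      ‖(∫ x : ℝ in (-1 / 2 : ℝ)..(1 / 2), f (x + Y' * I) * integerPoleKernel (x + Y' * I - s)) -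
        ∫ x : ℝ in (-1 / 2 : ℝ)..(1 / 2), f (x + Y' * I) * integerPoleKernel (x + Y' * I - 0)‖ ≤
      C * M := by
    intro Y' hY'
    have n1 : Y' ≠ s.im := by
      rintro rfl
      have := (Complex.abs_im_le_norm s).trans hs
      linarith
    have n2 : Y' ≠ (0 : ℂ).im := by
      rintro rfl
      simp at hY'
      linarith
    have hc1 := hhc s Y' n1
    have hc2 := hhc 0 Y' n2
    rw [← intervalIntegral.integral_sub ((by fun_prop : Continuous _).intervalIntegrable _ _)
      ((by fun_prop : Continuous _).intervalIntegrable _ _)]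
    refine (intervalIntegral.norm_integral_le_of_norm_le_const (C := C * M) fun x hx => ?_).trans
      (le_of_eq ?_)
    · rw [Set.uIoc_of_le (by norm_num)] at hx
      have hx' : |x| ≤ 1 / 2 := abs_le.2 ⟨by linarith [hx.1], hx.2⟩
      rw [← mul_sub, norm_mul, sub_zero]
      have hk := norm_integerPoleKernel_sub_le (z := x + Y' * I) hs
        (Or.inr (by simp [hY']; exact hY))
      have him : ((x : ℂ) + Y' * I).im = Y' := by simp
      rw [him, hY'] at hk
      calc _ ≤ (M * Real.exp (2 * π * Y)) * (C * Real.exp (-(2 * π * Y))) := by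
            gcongr
            exact hhor x Y' hx' hY'
        _ = C * M := by rw [Real.exp_neg]; field_simp
    · norm_num
  have hv : ‖(∫ y : ℝ in (-Y)..Y, (f ((1 / 2 : ℝ) + y * I) - f ((-1 / 2 : ℝ) + y * I)) *
        integerPoleKernel ((1 / 2 : ℝ) + y * I - s)) -
      ∫ y : ℝ in (-Y)..Y, (f ((1 / 2 : ℝ) + y * I) - f ((-1 / 2 : ℝ) + y * I)) *
        integerPoleKernel ((1 / 2 : ℝ) + y * I - 0)‖ ≤ C * M * (2 * Y) := by
    have hc1 := hvc s hs
    have hc2 := hvc 0 h0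
    have hc3 : Continuous fun y : ℝ => f ((1 / 2 : ℝ) + y * I) - f ((-1 / 2 : ℝ) + y * I) := by
      fun_prop
    rw [← intervalIntegral.integral_sub ((hc3.fun_mul hc1).intervalIntegrable _ _)
      ((hc3.fun_mul hc2).intervalIntegrable _ _)]
    refine (intervalIntegral.norm_integral_le_of_norm_le_const (C := C * M) fun y hy => ?_).trans
      (le_of_eq ?_)
    · rw [Set.uIoc_of_le (by linarith)] at hy
      have hy' : |y| ≤ Y := abs_le.2 ⟨hy.1.le, hy.2⟩
      rw [← mul_sub, norm_mul, sub_zero]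
      have hk := norm_integerPoleKernel_sub_le (z := (1 / 2 : ℝ) + y * I) hs
        (Or.inl (by simp))
      have him : (((1 / 2 : ℝ) : ℂ) + y * I).im = y := by simp
      rw [him] at hk
      calc _ ≤ (M * Real.exp (2 * π * |y|)) * (C * Real.exp (-(2 * π * |y|))) := by
            gcongr
            exact hver y hy'
        _ = C * M := by rw [Real.exp_neg]; field_simp
    · rw [abs_of_nonneg (by linarith)]; ring
  have e1 := eq_boundary_integral hf hs hY
  have e2 := eq_boundary_integral hf h0 hY
  have t1 := hh Y (abs_of_nonneg (by linarith))
  have t2 := hh (-Y) (by rw [abs_neg, abs_of_nonneg (by linarith)])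
  rw [e1, e2]
  have key : ∀ A₁ A₂ B₁ B₂ C₁ C₂ : ℂ, ‖A₁ - A₂‖ ≤ C * M → ‖B₁ - B₂‖ ≤ C * M →
      ‖C₁ - C₂‖ ≤ C * M * (2 * Y) →
      ‖A₁ - B₁ - I * C₁ - (A₂ - B₂ - I * C₂)‖ ≤ C * (2 + 2 * Y) * M := by
    intro A₁ A₂ B₁ B₂ C₁ C₂ h1 h2 h3
    calc ‖A₁ - B₁ - I * C₁ - (A₂ - B₂ - I * C₂)‖
        = ‖(A₁ - A₂) - (B₁ - B₂) - I * (C₁ - C₂)‖ := by ring_nf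
      _ ≤ ‖(A₁ - A₂) - (B₁ - B₂)‖ + ‖I * (C₁ - C₂)‖ := norm_sub_le _ _
      _ ≤ ‖A₁ - A₂‖ + ‖B₁ - B₂‖ + ‖I * (C₁ - C₂)‖ := by gcongr; exact norm_sub_le _ _
      _ ≤ C * M + C * M + C * M * (2 * Y) := by
          rw [norm_mul, norm_I, one_mul]
          gcongr
      _ = _ := by ring
  exact key _ _ _ _ _ _ t1 t2 hv

end ContourFormula

section GammaTermBounds

open Complex Filter Topology
open scoped Real Nat

theorem log_factorial_le {n : ℕ} (hn : 1 ≤ n) :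
    Real.log (n ! : ℝ) ≤ n * Real.log n - n + Real.log n + 1 := by
  induction n, hn using Nat.le_induction with
  | base => simp
  | succ n hn ih =>
    have hn0 : (0 : ℝ) < n := by exact_mod_cast hn
    have h1 : Real.log ((n + 1)! : ℝ) = Real.log (n + 1) + Real.log (n ! : ℝ) := by
      rw [Nat.factorial_succ]
      push_cast
      rw [Real.log_mul (by positivity) (by positivity)]
    have h2 : Real.log n - Real.log (n + 1) ≤ n / (n + 1) - 1 := by
      rw [← Real.log_div (by positivity) (by positivity)]
      exact Real.log_le_sub_one_of_pos (by positivity)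
    have h3 : ((n : ℝ) + 1) * (Real.log n - Real.log (n + 1)) ≤ -1 := by
      calc _ ≤ ((n : ℝ) + 1) * (n / (n + 1) - 1) := by gcongr
        _ = -1 := by field_simp; ring
    rw [h1]
    push_cast
    linarith

/-- The entire interpolation of `m ↦ C(n, m) ^ a * (n - m)! / n!`. -/
noncomputable def gammaTerm (a n : ℕ) (z : ℂ) : ℂ :=
  (n ! : ℂ) ^ (a - 1) * (Gamma (z + 1))⁻¹ ^ a * (Gamma (n + 1 - z))⁻¹ ^ (a - 1)

theorem differentiable_gammaTerm (a n : ℕ) : Differentiable ℂ (gammaTerm a n) := by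
  have h1 : Differentiable ℂ fun z : ℂ => (Gamma (z + 1))⁻¹ :=
    differentiable_one_div_Gamma.comp (by fun_prop : Differentiable ℂ fun z : ℂ => z + 1)
  have h2 : Differentiable ℂ fun z : ℂ => (Gamma (n + 1 - z))⁻¹ :=
    differentiable_one_div_Gamma.comp (by fun_prop : Differentiable ℂ fun z : ℂ => n + 1 - z)
  unfold gammaTerm
  fun_prop

theorem norm_gammaTerm_conj (a n : ℕ) (z : ℂ) :
    ‖gammaTerm a n (starRingEnd ℂ z)‖ = ‖gammaTerm a n z‖ := by
  have h1 : starRingEnd ℂ z + 1 = starRingEnd ℂ (z + 1) := by simp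
  have h2 : n + 1 - starRingEnd ℂ z = starRingEnd ℂ (n + 1 - z) := by simp
  rw [gammaTerm, h1, h2, Gamma_conj, Gamma_conj]
  simp [gammaTerm]

theorem norm_inv_Gamma_le {x y : ℝ} (hx : -1 < x) (hy : 0 ≤ y) :
    ‖(Gamma ((x : ℂ) + 1 + y * I))⁻¹‖ ≤ (x + 1 + y) * Real.exp (-stirlingExponent (x + 1) y) := by
  have h := exp_stirlingExponent_le_norm_Gamma (x := x + 1) (by linarith) hy
  have hne : (x : ℂ) + 1 + y * I ≠ 0 := fun h0 => by
    have := congrArg Complex.re h0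
    simp at this
    linarith
  have h1 : ((x + 1 : ℝ) : ℂ) + 1 + y * I = (x + 1 + y * I : ℂ) + 1 := by push_cast; ring
  rw [h1, Gamma_add_one _ hne, norm_mul] at h
  have h2 : ‖(x : ℂ) + 1 + y * I‖ ≤ x + 1 + y := by
    refine (Complex.norm_le_abs_re_add_abs_im _).trans (le_of_eq ?_)
    simp [abs_of_nonneg hy, abs_of_nonneg (by linarith : 0 ≤ x + 1)]
  have h3 : 0 < ‖Gamma ((x : ℂ) + 1 + y * I)‖ := by
    by_contra h4
    have h5 := le_antisymm (not_lt.1 h4) (norm_nonneg _)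
    rw [h5, mul_zero] at h
    exact absurd h (not_le.2 (Real.exp_pos _))
  rw [norm_inv, Real.exp_neg, ← div_eq_mul_inv, le_div_iff₀ (Real.exp_pos _), inv_mul_le_iff₀ h3,
    mul_comm]
  exact h.trans (by gcongr)

theorem factorial_mul_norm_inv_Gamma_le {n : ℕ} {x y : ℝ} (hn : 1 ≤ n) (hx0 : -1 / 2 ≤ x)
    (hx : x ≤ n + 1 / 2) (hy : 0 ≤ y) (hyn : y ≤ n) :
    n ! * ‖(Gamma (n + 1 - ((x : ℂ) + y * I)))⁻¹‖ ≤
      (12 * n) * n * Real.exp (x * Real.log n + 2 * y ^ 2 / n) := by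
  have hn1 : (1 : ℝ) ≤ n := by exact_mod_cast hn
  have hn0 : (0 : ℝ) < n := by linarith
  have hlog : 0 ≤ Real.log n := Real.log_nonneg hn1
  have hconj : (n + 1 - ((x : ℂ) + y * I)) =
      starRingEnd ℂ (((n - x : ℝ) : ℂ) + 1 + y * I) := by
    simp; ring
  rw [hconj, Gamma_conj, ← map_inv₀, RCLike.norm_conj]
  have h1 := norm_inv_Gamma_le (x := n - x) (by linarith) hy
  have ht := stirlingExponent_tangent_le (x := n - x + 1) (c := n) (y := y) (by linarith) hn0.le
    (Or.inl ⟨by linarith, hn0⟩)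
  have hq := sub_sq_le_stirlingExponent hn0 hy
  have hf := log_factorial_le hn
  have hl : Real.log (n ^ 2 + y ^ 2) = 2 * Real.log n + Real.log (1 + (y / n) ^ 2) := by
    rw [show (n : ℝ) ^ 2 + y ^ 2 = n ^ 2 * (1 + (y / n) ^ 2) by field_simp,
      Real.log_mul (by positivity) (by positivity), Real.log_pow]
    push_cast; ring
  have hl0 : 0 ≤ Real.log (1 + (y / n) ^ 2) :=
    Real.log_nonneg (by nlinarith [sq_nonneg (y / n)])
  have hl1 : Real.log (1 + (y / n) ^ 2) ≤ (y / n) ^ 2 := by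
    have := Real.log_le_sub_one_of_pos (x := 1 + (y / n) ^ 2) (by positivity)
    linarith
  have hl2 : (x - 1) * (Real.log (1 + (y / n) ^ 2) / 2) ≤ y ^ 2 / n := by
    have hz : 0 ≤ y ^ 2 / n := by positivity
    rcases le_total x 1 with h | h
    · exact (mul_nonpos_of_nonpos_of_nonneg (by linarith) (by linarith)).trans hz
    · calc (x - 1) * (Real.log (1 + (y / n) ^ 2) / 2) ≤ n * ((y / n) ^ 2 / 1) := by
            gcongr
            · linarith
            · norm_num
        _ = y ^ 2 / n := by field_simp
  have hkey : Real.log (n ! : ℝ) - stirlingExponent (n - x + 1) y ≤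
      x * Real.log n + 2 * y ^ 2 / n + 1 := by
    rw [hl] at ht
    have : 2 * y ^ 2 / n = y ^ 2 / n + y ^ 2 / n := by ring
    nlinarith
  have hfac : (n ! : ℝ) = Real.exp (Real.log (n ! : ℝ)) := (Real.exp_log (by positivity)).symm
  have he : Real.exp 1 ≤ 3 := by linarith [Real.exp_one_lt_d9]
  calc n ! * ‖(Gamma (((n - x : ℝ) : ℂ) + 1 + y * I))⁻¹‖
      ≤ n ! * ((n - x + 1 + y) * Real.exp (-stirlingExponent (n - x + 1) y)) := by gcongr
    _ = (n - x + 1 + y) * Real.exp (Real.log (n ! : ℝ) - stirlingExponent (n - x + 1) y) := by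
        rw [sub_eq_add_neg (Real.log _), Real.exp_add, ← hfac]; ring
    _ ≤ (4 * n) * Real.exp (x * Real.log n + 2 * y ^ 2 / n + 1) := by
        gcongr
        linarith
    _ = (4 * n) * Real.exp 1 * 1 * Real.exp (x * Real.log n + 2 * y ^ 2 / n) := by
        rw [Real.exp_add]; ring
    _ ≤ (4 * n) * 3 * n * Real.exp (x * Real.log n + 2 * y ^ 2 / n) := by gcongr
    _ = _ := by ring

theorem norm_gammaTerm_le {a n : ℕ} {x y : ℝ} (ha : 1 ≤ a) (hn : 1 ≤ n) (hx0 : -1 / 2 ≤ x)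
    (hx : x ≤ n + 1 / 2) (hy : 0 ≤ y) (hyn : y ≤ n) :
    ‖gammaTerm a n (x + y * I)‖ ≤ ((12 * n) * n) ^ (2 * a) *
      Real.exp ((a - 1) * (x * Real.log n + 2 * y ^ 2 / n) - a * stirlingExponent (x + 1) y) := by
  have hn1 : (1 : ℝ) ≤ n := by exact_mod_cast hn
  have h1 := norm_inv_Gamma_le (x := x) (by linarith) hy
  have h2 := factorial_mul_norm_inv_Gamma_le hn hx0 hx hy hyn
  have h3 : ((x : ℂ) + y * I) + 1 = x + 1 + y * I := by ring
  have h4 : ‖gammaTerm a n (x + y * I)‖ =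
      (n ! * ‖(Gamma (n + 1 - ((x : ℂ) + y * I)))⁻¹‖) ^ (a - 1) *
        ‖(Gamma ((x : ℂ) + 1 + y * I))⁻¹‖ ^ a := by
    rw [gammaTerm, h3, norm_mul, norm_mul, norm_pow, norm_pow, norm_pow, mul_pow, norm_natCast]
    ring
  have h5 : (12 * n * n : ℝ) ≥ 1 := by nlinarith
  have h6 : x + 1 + y ≤ 12 * n * n := by nlinarith
  have ha1 : ((a - 1 : ℕ) : ℝ) = a - 1 := by rw [Nat.cast_sub ha]; simp
  rw [h4]
  calc _ ≤ ((12 * n) * n * Real.exp (x * Real.log n + 2 * y ^ 2 / n)) ^ (a - 1) *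
        (((12 * n) * n) * Real.exp (-stirlingExponent (x + 1) y)) ^ a := by
        gcongr
        refine h1.trans ?_
        gcongr
    _ = ((12 * n) * n) ^ (a - 1 + a) * Real.exp ((a - 1) * (x * Real.log n + 2 * y ^ 2 / n) -
          a * stirlingExponent (x + 1) y) := by
        rw [mul_pow _ (Real.exp _), mul_pow _ (Real.exp _), ← Real.exp_nat_mul,
          ← Real.exp_nat_mul, ha1, pow_add, sub_eq_add_neg (((a : ℝ) - 1) * _), Real.exp_add]
        ring_nf
    _ ≤ _ := by
        gcongr
        omega

/-- On the horizontal lines `Im z = Y` the exponent of `norm_gammaTerm_le` is controlled by the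
saddle point `N * exp (i * θ)`. -/
theorem stirlingExponent_polar_le {x N θ : ℝ} (hx : -1 / 2 ≤ x) (hN : 1 ≤ N) (hθ : 0 < θ)
    (hθ2 : θ ≤ π / 2) :
    x * Real.log N - stirlingExponent (x + 1) (N * Real.sin θ) ≤
      θ * (N * Real.sin θ) + N * Real.cos θ := by
  have hs : 0 < Real.sin θ := Real.sin_pos_of_pos_of_lt_pi hθ (by linarith [Real.pi_pos])
  have hc : 0 ≤ Real.cos θ := Real.cos_nonneg_of_mem_Icc ⟨by linarith, hθ2⟩
  have hN0 : 0 < N := by linarith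
  have ht := stirlingExponent_tangent_le (x := x + 1) (c := N * Real.cos θ)
    (y := N * Real.sin θ) (by linarith) (by positivity) (Or.inr (by positivity))
  have h1 : (N * Real.cos θ) ^ 2 + (N * Real.sin θ) ^ 2 = N ^ 2 := by
    linear_combination N ^ 2 * Real.sin_sq_add_cos_sq θ
  have h2 : Real.arctan ((N * Real.cos θ) / (N * Real.sin θ)) = π / 2 - θ := by
    rw [mul_div_mul_left _ _ hN0.ne']
    refine Real.arctan_eq_of_tan_eq ?_ ⟨by linarith, by linarith⟩
    rw [Real.tan_eq_sin_div_cos, Real.sin_pi_div_two_sub, Real.cos_pi_div_two_sub]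
  rw [h1, stirlingExponent, h1, h2, Real.log_pow] at ht
  have := Real.log_nonneg hN
  push_cast at ht
  linarith

theorem sub_mul_sin_le_cos {θ : ℝ} (hθ : 0 < θ) (hθ2 : θ ≤ π / 2) :
    (π / 2 - θ) * Real.sin θ ≤ Real.cos θ := by
  have hs : 0 < Real.sin θ := Real.sin_pos_of_pos_of_lt_pi hθ (by linarith [Real.pi_pos])
  have h := Real.le_tan (x := π / 2 - θ) (by linarith) (by linarith)
  rwa [Real.tan_eq_sin_div_cos, Real.sin_pi_div_two_sub, Real.cos_pi_div_two_sub,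
    le_div_iff₀ hs] at h

section bounds

variable {a n : ℕ} {N θ : ℝ}

theorem norm_gammaTerm_horizontal_le (ha : 4 ≤ a) (hn : 1 ≤ n) (hN : 1 ≤ N) (hNn : N ≤ n)
    (hNlog : a * Real.log N = (a - 1) * Real.log n) (hθ : a * θ = 2 * π) {x y : ℝ}
    (hx0 : -1 / 2 ≤ x) (hx : x ≤ n + 1 / 2) (hy : |y| = N * Real.sin θ) :
    ‖gammaTerm a n (x + y * I)‖ ≤ ((12 * n) * n) ^ (2 * a) * Real.exp (2 * a * N ^ 2 / n + 2 * a) *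
      Real.exp (a * N * Real.cos θ) * Real.exp (2 * π * |y|) := by
  wlog hy0 : 0 ≤ y generalizing y
  · have := this (y := -y) (by rwa [abs_neg]) (by linarith)
    rw [abs_neg, ← norm_gammaTerm_conj] at this
    simpa using this
  have ha4 : (4 : ℝ) ≤ a := by exact_mod_cast ha
  have hn1 : (1 : ℝ) ≤ n := by exact_mod_cast hn
  have hθ0 : 0 < θ := by
    by_contra h
    nlinarith [Real.pi_pos]
  have hθ2 : θ ≤ π / 2 := by nlinarith
  rw [abs_of_nonneg hy0] at *
  have hyN : y ≤ N := by rw [hy]; nlinarith [Real.sin_le_one θ]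
  refine (norm_gammaTerm_le (by omega) hn hx0 hx hy0 (hyN.trans hNn)).trans ?_
  rw [mul_assoc (_ ^ _), mul_assoc (_ ^ _), ← Real.exp_add, ← Real.exp_add]
  have hp := stirlingExponent_polar_le hx0 hN hθ0 hθ2
  rw [← hy] at hp
  have hp2 := mul_le_mul_of_nonneg_left hp (by linarith : (0:ℝ) ≤ a)
  have h1 : (a - 1) * (2 * y ^ 2 / n) ≤ 2 * a * N ^ 2 / n := by
    calc ((a : ℝ) - 1) * (2 * y ^ 2 / n) ≤ a * (2 * N ^ 2 / n) := by gcongr; linarith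
      _ = _ := by ring
  gcongr
  have h2 : a * (θ * y) = 2 * π * y := by rw [← hθ]; ring
  have h3 : a * (x * Real.log N) = (a - 1) * (x * Real.log n) := by linear_combination x * hNlog
  rw [mul_sub, mul_add, h2, h3] at hp2
  linarith

theorem norm_gammaTerm_vertical_le (ha : 4 ≤ a) (hn : 1 ≤ n) (hna : a ≤ Real.log n) (hN : 1 ≤ N)
    (hNn : N ≤ n) (hθ : a * θ = 2 * π) {x y : ℝ}
    (hx : x = -1 / 2 ∨ x = n + 1 / 2) (hy : |y| ≤ N * Real.sin θ) :
    ‖gammaTerm a n (x + y * I)‖ ≤ ((12 * n) * n) ^ (2 * a) * Real.exp (2 * a * N ^ 2 / n + 2 * a) *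
      Real.exp (a * N * Real.cos θ) * Real.exp (2 * π * |y|) := by
  wlog hy0 : 0 ≤ y generalizing y
  · have := this (y := -y) (by rwa [abs_neg]) (by linarith)
    rw [abs_neg, ← norm_gammaTerm_conj] at this
    simpa using this
  have ha4 : (4 : ℝ) ≤ a := by exact_mod_cast ha
  have hn1 : (1 : ℝ) ≤ n := by exact_mod_cast hn
  have hθ0 : 0 < θ := by
    by_contra h
    nlinarith [Real.pi_pos]
  have hθ2 : θ ≤ π / 2 := by nlinarith
  rw [abs_of_nonneg hy0] at *
  have hyN : y ≤ N := by nlinarith [Real.sin_le_one θ]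
  have hx0 : -1 / 2 ≤ x := by rcases hx with h | h <;> linarith
  have hx1 : x ≤ n + 1 / 2 := by rcases hx with h | h <;> linarith
  refine (norm_gammaTerm_le (by omega) hn hx0 hx1 hy0 (hyN.trans hNn)).trans ?_
  rw [mul_assoc (_ ^ _), mul_assoc (_ ^ _), ← Real.exp_add, ← Real.exp_add]
  have h1 : (a - 1) * (2 * y ^ 2 / n) ≤ 2 * a * N ^ 2 / n := by
    calc ((a : ℝ) - 1) * (2 * y ^ 2 / n) ≤ a * (2 * N ^ 2 / n) := by gcongr; linarith
      _ = _ := by ring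
  have h2 : a * (π / 2) * y ≤ 2 * π * y + a * N * Real.cos θ := by
    have e1 : (a * (π / 2) - 2 * π) * y ≤ (a * (π / 2) - 2 * π) * (N * Real.sin θ) := by
      gcongr
      nlinarith [Real.pi_pos]
    have e2 : a * N * ((π / 2 - θ) * Real.sin θ) ≤ a * N * Real.cos θ := by
      gcongr
      exact sub_mul_sin_le_cos hθ0 hθ2
    rw [← hθ] at e1 ⊢
    linarith
  have hS := sub_le_stirlingExponent (x := x + 1) (y := y) (by linarith) hy0
  have h3 : (a - 1) * (x * Real.log n) - a * ((x + 1) * Real.log (x + 1) - (x + 1)) ≤ 2 * a := by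
    have hl0 := Real.log_nonneg hn1
    rcases hx with h | h
    · have hl : -Real.log (1 / 2) ≤ 1 := by
        rw [one_div, Real.log_inv, neg_neg]; linarith [Real.log_two_lt_d9]
      rw [h, show (-1 / 2 + 1 : ℝ) = 1 / 2 by norm_num]
      nlinarith [mul_nonneg (by linarith : (0:ℝ) ≤ a - 1) hl0]
    · have hl : Real.log n ≤ Real.log (n + 1 / 2 + 1) :=
        Real.log_le_log (by linarith) (by linarith)
      rw [h]
      have e1 : a * ((n + 1 / 2 + 1) * Real.log n) ≤
          a * ((n + 1 / 2 + 1 : ℝ) * Real.log (n + 1 / 2 + 1)) := by gcongr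
      have e2 : n * (a : ℝ) ≤ n * Real.log n := by gcongr
      have e3 : 0 ≤ a * Real.log n := by positivity
      linarith
  have hp2 := mul_le_mul_of_nonneg_left hS (by linarith : (0:ℝ) ≤ a)
  gcongr
  linarith

end bounds

end GammaTermBounds

section GammaSumBound

open Complex Filter Topology
open scoped Real Nat

noncomputable def gammaSum (a n : ℕ) (s : ℂ) : ℂ :=
  ∑ m ∈ Finset.range (n + 1), gammaTerm a n (m + s)

theorem differentiable_gammaSum (a n : ℕ) : Differentiable ℂ (gammaSum a n) := by
  unfold gammaSum
  refine Differentiable.fun_sum fun m _ => ?_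
  exact (differentiable_gammaTerm a n).comp (by fun_prop : Differentiable ℂ fun s : ℂ => m + s)

theorem norm_gammaSum_sub_le {a n : ℕ} {N θ : ℝ} (ha : 4 ≤ a) (hn : 1 ≤ n)
    (hna : a ≤ Real.log n) (hN : 1 ≤ N) (hNn : N ≤ n)
    (hNlog : a * Real.log N = (a - 1) * Real.log n) (hθ : a * θ = 2 * π)
    (hY : 1 ≤ N * Real.sin θ) {s : ℂ} (hs : ‖s‖ ≤ 1 / 4) :
    ‖gammaSum a n s - gammaSum a n 0‖ ≤
      4 * (1 + Real.exp 2) * Real.exp 2 * (2 + 2 * (N * Real.sin θ)) * (2 * (n + 1) *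
        (((12 * n) * n) ^ (2 * a) * Real.exp (2 * a * N ^ 2 / n + 2 * a) *
          Real.exp (a * N * Real.cos θ))) := by
  have hn1 : (1 : ℝ) ≤ n := by exact_mod_cast hn
  set K := ((12 * n : ℝ) * n) ^ (2 * a) * Real.exp (2 * a * N ^ 2 / n + 2 * a) *
          Real.exp (a * N * Real.cos θ) with hK
  have hK0 : 0 ≤ K := by positivity
  have hcast : ∀ (m : ℕ) (x y : ℝ), (m : ℂ) + (x + y * I) = ((m + x : ℝ) : ℂ) + y * I := by
    intros; push_cast; ring
  refine norm_sub_apply_zero_le (differentiable_gammaSum a n) hs hY ?_ ?_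
  · intro x y hx hy
    have hx' := abs_le.1 hx
    calc ‖gammaSum a n (x + y * I)‖
        ≤ ∑ m ∈ Finset.range (n + 1), ‖gammaTerm a n (m + (x + y * I))‖ := norm_sum_le _ _
      _ ≤ ∑ m ∈ Finset.range (n + 1), K * Real.exp (2 * π * |y|) := by
          refine Finset.sum_le_sum fun m hm => ?_
          have hm' : (m : ℝ) ≤ n := by
            exact_mod_cast Nat.lt_succ_iff.1 (Finset.mem_range.1 hm)
          have hm0 : (0 : ℝ) ≤ m := m.cast_nonneg
          rw [hcast]
          exact norm_gammaTerm_horizontal_le ha hn hN hNn hNlog hθ (by linarith) (by linarith) hy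
      _ = 1 * (n + 1) * K * Real.exp (2 * π * (N * Real.sin θ)) := by
          rw [Finset.sum_const, Finset.card_range, nsmul_eq_mul, hy]; push_cast; ring
      _ ≤ 2 * (n + 1) * K * Real.exp (2 * π * (N * Real.sin θ)) := by gcongr; norm_num
  · intro y hy
    have htel : gammaSum a n ((1 / 2 : ℝ) + y * I) - gammaSum a n ((-1 / 2 : ℝ) + y * I) =
        gammaTerm a n ((n + 1 / 2 : ℝ) + y * I) - gammaTerm a n ((-1 / 2 : ℝ) + y * I) := by
      rw [gammaSum, gammaSum, ← Finset.sum_sub_distrib]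
      have h := Finset.sum_range_sub
        (fun m : ℕ => gammaTerm a n (m + ((-1 / 2 : ℝ) + y * I))) (n + 1)
      have h0 : ((n + 1 : ℕ) : ℂ) + ((-1 / 2 : ℝ) + y * I) = ((n + 1 / 2 : ℝ) : ℂ) + y * I := by
        push_cast; ring
      rw [h0, Nat.cast_zero, zero_add] at h
      rw [← h]
      refine Finset.sum_congr rfl fun m _ => ?_
      congr 2
      push_cast; ring
    rw [htel]
    refine (norm_sub_le _ _).trans ?_
    have b1 := norm_gammaTerm_vertical_le ha hn hna hN hNn hθ (x := n + 1 / 2) (Or.inr rfl) hy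
    have b2 := norm_gammaTerm_vertical_le ha hn hna hN hNn hθ (x := -1 / 2) (Or.inl rfl) hy
    rw [← hK] at b1 b2
    calc _ ≤ K * Real.exp (2 * π * |y|) + K * Real.exp (2 * π * |y|) := add_le_add b1 b2
      _ = 2 * 1 * K * Real.exp (2 * π * |y|) := by ring
      _ ≤ _ := by gcongr; linarith

end GammaSumBound

section Jets

open Complex Filter Topology Asymptotics
open scoped Real Nat

/-- `f` agrees with the cubic polynomial with coefficients `c₀, c₁, c₂, c₃` up to `O(s ^ 4)`
at `0`. -/
def HasCubicJet (f : ℂ → ℂ) (c₀ c₁ c₂ c₃ : ℂ) : Prop :=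
  (fun s => f s - (c₀ + c₁ * s + c₂ * s ^ 2 + c₃ * s ^ 3)) =O[𝓝 0] fun s : ℂ => s ^ 4

theorem hasCubicJet_polynomial (c₀ c₁ c₂ c₃ : ℂ) :
    HasCubicJet (fun s => c₀ + c₁ * s + c₂ * s ^ 2 + c₃ * s ^ 3) c₀ c₁ c₂ c₃ := by
  simp only [HasCubicJet, sub_self]
  exact isBigO_zero _ _

theorem hasCubicJet_const (c : ℂ) : HasCubicJet (fun _ => c) c 0 0 0 := by
  simpa using hasCubicJet_polynomial c 0 0 0

theorem continuousAt_isBigO_one {r : ℂ → ℂ} (hr : ContinuousAt r 0) :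
    r =O[𝓝 0] fun _ => (1 : ℂ) := hr.tendsto.isBigO_one ℂ

namespace HasCubicJet

variable {f g : ℂ → ℂ} {c₀ c₁ c₂ c₃ d₀ d₁ d₂ d₃ : ℂ}

theorem congr (hf : HasCubicJet f c₀ c₁ c₂ c₃) (h : f =ᶠ[𝓝 0] g) : HasCubicJet g c₀ c₁ c₂ c₃ :=
  IsBigO.congr' hf (h.mono fun s hs => by simp only [hs]) EventuallyEq.rfl

theorem congr_coeff (hf : HasCubicJet f c₀ c₁ c₂ c₃) (h₀ : c₀ = d₀) (h₁ : c₁ = d₁)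
    (h₂ : c₂ = d₂) (h₃ : c₃ = d₃) : HasCubicJet f d₀ d₁ d₂ d₃ := by
  rwa [← h₀, ← h₁, ← h₂, ← h₃]

theorem isBigO_one (hf : HasCubicJet f c₀ c₁ c₂ c₃) : f =O[𝓝 0] fun _ => (1 : ℂ) := by
  have h1 : (fun s : ℂ => s ^ 4) =O[𝓝 0] fun _ => (1 : ℂ) := continuousAt_isBigO_one (by fun_prop)
  have h2 : (fun s : ℂ => c₀ + c₁ * s + c₂ * s ^ 2 + c₃ * s ^ 3) =O[𝓝 0] fun _ => (1 : ℂ) :=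
    continuousAt_isBigO_one (by fun_prop)
  simpa using (IsBigO.trans hf h1).add h2

theorem isBigO_id (hf : HasCubicJet f 0 c₁ c₂ c₃) : f =O[𝓝 0] fun s => s := by
  have h1 : (fun s : ℂ => s ^ 4) =O[𝓝 0] fun s => s := by
    have := (continuousAt_isBigO_one (r := fun s : ℂ => s ^ 3) (by fun_prop)).mul
      (isBigO_refl (fun s : ℂ => s) (𝓝 0))
    exact this.congr (fun s => by ring) fun s => one_mul s
  have h2 : (fun s : ℂ => (c₁ + c₂ * s + c₃ * s ^ 2) * s) =O[𝓝 0] fun s => s := by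
    simpa using (continuousAt_isBigO_one (r := fun s : ℂ => c₁ + c₂ * s + c₃ * s ^ 2)
      (by fun_prop)).mul (isBigO_refl (fun s : ℂ => s) (𝓝 0))
  refine ((IsBigO.trans hf h1).add h2).congr_left fun s => ?_
  ring

theorem add (hf : HasCubicJet f c₀ c₁ c₂ c₃) (hg : HasCubicJet g d₀ d₁ d₂ d₃) :
    HasCubicJet (fun s => f s + g s) (c₀ + d₀) (c₁ + d₁) (c₂ + d₂) (c₃ + d₃) :=
  (IsBigO.add hf hg).congr_left fun s => by ring

theorem const_mul (hf : HasCubicJet f c₀ c₁ c₂ c₃) (k : ℂ) :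
    HasCubicJet (fun s => k * f s) (k * c₀) (k * c₁) (k * c₂) (k * c₃) :=
  (IsBigO.const_mul_left hf k).congr_left fun s => by ring

theorem sum {ι : Type*} {t : Finset ι} {F : ι → ℂ → ℂ} {e₀ e₁ e₂ e₃ : ι → ℂ}
    (h : ∀ i ∈ t, HasCubicJet (F i) (e₀ i) (e₁ i) (e₂ i) (e₃ i)) :
    HasCubicJet (fun s => ∑ i ∈ t, F i s) (∑ i ∈ t, e₀ i) (∑ i ∈ t, e₁ i) (∑ i ∈ t, e₂ i)
      (∑ i ∈ t, e₃ i) := by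
  refine (IsBigO.sum h).congr_left fun s => ?_
  simp only [Finset.sum_apply, Finset.sum_sub_distrib, Finset.sum_add_distrib, Finset.sum_mul]

theorem comp_neg (hf : HasCubicJet f c₀ c₁ c₂ c₃) :
    HasCubicJet (fun s => f (-s)) c₀ (-c₁) c₂ (-c₃) := by
  have h : Tendsto (fun s : ℂ => -s) (𝓝 0) (𝓝 0) := by
    simpa using (continuous_neg (G := ℂ)).tendsto 0
  refine (IsBigO.comp_tendsto hf h).congr (fun s => ?_) fun s => ?_ <;>
    simp only [Function.comp_apply] <;> ring

theorem mul (hf : HasCubicJet f c₀ c₁ c₂ c₃) (hg : HasCubicJet g d₀ d₁ d₂ d₃) :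
    HasCubicJet (fun s => f s * g s) (c₀ * d₀) (c₀ * d₁ + c₁ * d₀)
      (c₀ * d₂ + c₁ * d₁ + c₂ * d₀) (c₀ * d₃ + c₁ * d₂ + c₂ * d₁ + c₃ * d₀) := by
  have h1 := IsBigO.mul hf hg.isBigO_one
  have h2 := IsBigO.mul (hasCubicJet_polynomial c₀ c₁ c₂ c₃).isBigO_one hg
  have h3 : (fun s : ℂ => s ^ 4 * ((c₁ * d₃ + c₂ * d₂ + c₃ * d₁) +
      (c₂ * d₃ + c₃ * d₂) * s + c₃ * d₃ * s ^ 2)) =O[𝓝 0] fun s => s ^ 4 * 1 :=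
    (isBigO_refl _ _).mul (continuousAt_isBigO_one (by fun_prop))
  simp only [mul_one, one_mul] at h1 h2 h3
  refine ((h1.add h2).add h3).congr_left fun s => ?_
  ring

theorem exp (hf : HasCubicJet f 0 c₁ c₂ c₃) :
    HasCubicJet (fun s => exp (f s)) 1 c₁ (c₁ ^ 2 / 2 + c₂) (c₁ ^ 3 / 6 + c₁ * c₂ + c₃) := by
  have h0 : Tendsto f (𝓝 0) (𝓝 0) := hf.isBigO_id.trans_tendsto tendsto_id
  have h1 := ((exp_sub_sum_range_isBigO_pow 4).comp_tendsto h0).trans (hf.isBigO_id.pow 4)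
  have h2 := (((hasCubicJet_const 1).add hf).add ((hf.mul hf).const_mul (1 / 2))).add
    ((hf.mul (hf.mul hf)).const_mul (1 / 6))
  refine (h1.add h2).congr_left fun s => ?_
  simp [Finset.sum_range_succ, Nat.factorial]
  ring

theorem eq_zero_of_isBigO {e : ℂ} {r : ℂ → ℂ} {k : ℕ} (hr : ContinuousAt r 0)
    (h : (fun s => e + s * r s) =O[𝓝[≠] 0] fun s : ℂ => s ^ (k + 1)) :
    e = 0 ∧ r =O[𝓝[≠] 0] fun s : ℂ => s ^ k := by
  have h1 : Tendsto (fun s : ℂ => s ^ (k + 1)) (𝓝[≠] 0) (𝓝 0) := by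
    have : ContinuousAt (fun s : ℂ => s ^ (k + 1)) 0 := by fun_prop
    simpa using this.tendsto.mono_left nhdsWithin_le_nhds
  have h2 : Tendsto (fun s : ℂ => e + s * r s) (𝓝[≠] 0) (𝓝 e) := by
    have : ContinuousAt (fun s : ℂ => e + s * r s) 0 := by fun_prop
    simpa using this.tendsto.mono_left nhdsWithin_le_nhds
  have he : e = 0 := tendsto_nhds_unique h2 (h.trans_tendsto h1)
  refine ⟨he, ?_⟩
  have h3 := (isBigO_refl (fun s : ℂ => s⁻¹) (𝓝[≠] 0)).mul h
  refine h3.congr' ?_ ?_ <;> filter_upwards [self_mem_nhdsWithin] with s hs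
  · rw [he, zero_add, inv_mul_cancel_left₀ hs]
  · rw [pow_succ', inv_mul_cancel_left₀ hs]

theorem coeff_unique (hf : HasCubicJet f c₀ c₁ c₂ c₃) (hg : HasCubicJet f d₀ d₁ d₂ d₃) :
    c₀ = d₀ ∧ c₁ = d₁ ∧ c₂ = d₂ ∧ c₃ = d₃ := by
  have h : (fun s => (c₀ - d₀) + s * ((c₁ - d₁) + s * ((c₂ - d₂) + s * ((c₃ - d₃) + s * 0))))
      =O[𝓝[≠] 0] fun s : ℂ => s ^ (3 + 1) :=
    ((IsBigO.sub hg hf).congr_left fun s => by ring).mono nhdsWithin_le_nhds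
  obtain ⟨e0, h⟩ := eq_zero_of_isBigO (by fun_prop) h
  obtain ⟨e1, h⟩ := eq_zero_of_isBigO (by fun_prop) h
  obtain ⟨e2, h⟩ := eq_zero_of_isBigO (by fun_prop) h
  obtain ⟨e3, h⟩ := eq_zero_of_isBigO (by fun_prop) h
  exact ⟨sub_eq_zero.1 e0, sub_eq_zero.1 e1, sub_eq_zero.1 e2, sub_eq_zero.1 e3⟩

end HasCubicJet

/-- Cauchy estimates for the cubic jet of an entire function. -/
theorem exists_hasCubicJet_of_norm_le {f : ℂ → ℂ} (hf : Differentiable ℂ f) {B : ℝ}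
    (hB : ∀ s : ℂ, ‖s‖ ≤ 1 / 4 → ‖f s‖ ≤ B) :
    ∃ c₀ c₁ c₂ c₃ : ℂ, HasCubicJet f c₀ c₁ c₂ c₃ ∧ ‖c₀‖ ≤ 64 * B ∧ ‖c₁‖ ≤ 64 * B ∧
      ‖c₂‖ ≤ 64 * B ∧ ‖c₃‖ ≤ 64 * B := by
  have hB0 : 0 ≤ B := (norm_nonneg _).trans (hB 0 (by norm_num))
  have hp := (hf.hasFPowerSeriesOnBall 0 (R := 1 / 4) (by norm_num)).hasFPowerSeriesAt
  set p := cauchyPowerSeries f 0 ((1 / 4 : NNReal) : ℝ) with hpdef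
  have hcoef : ∀ k ≤ 3, ‖p.coeff k‖ ≤ 64 * B := by
    intro k hk
    have h1 := norm_cauchyPowerSeries_le f 0 ((1 / 4 : NNReal) : ℝ) k
    have h2 : ∫ θ : ℝ in 0..2 * π, ‖f (circleMap 0 ((1 / 4 : NNReal) : ℝ) θ)‖ ≤ 2 * π * B := by
      have := intervalIntegral.integral_mono_on (a := 0) (b := 2 * π)
        (f := fun θ : ℝ => ‖f (circleMap 0 ((1 / 4 : NNReal) : ℝ) θ)‖) (g := fun _ => B)
        (μ := MeasureTheory.volume) (by positivity)
        ((hf.continuous.comp (continuous_circleMap _ _)).norm.intervalIntegrable _ _)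
        (by simp) fun θ _ => hB _ (by simp)
      simpa using this
    have h3 : ‖p.coeff k‖ ≤ ‖p k‖ := by
      rw [FormalMultilinearSeries.coeff]
      refine ((p k).le_opNorm _).trans (le_of_eq ?_)
      simp
    refine h3.trans (h1.trans ?_)
    have h4 : |((1 / 4 : NNReal) : ℝ)|⁻¹ ^ k ≤ 64 := by
      have : |((1 / 4 : NNReal) : ℝ)|⁻¹ = 4 := by norm_num
      rw [this]
      calc (4 : ℝ) ^ k ≤ 4 ^ 3 := by gcongr; norm_num
        _ = 64 := by norm_num
    calc _ ≤ ((2 * π)⁻¹ * (2 * π * B)) * 64 := by gcongr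
      _ = 64 * B := by field_simp
  refine ⟨p.coeff 0, p.coeff 1, p.coeff 2, p.coeff 3, ?_, hcoef 0 (by norm_num),
    hcoef 1 (by norm_num), hcoef 2 (by norm_num), hcoef 3 (by norm_num)⟩
  have h := hp.isBigO_sub_partialSum_pow 4
  simp only [← norm_pow] at h
  refine IsBigO.congr_left h.of_norm_right fun s => ?_
  simp [FormalMultilinearSeries.partialSum, Finset.sum_range_succ]
  ring

end Jets

section LogGamma

open Complex Filter Topology Asymptotics
open scoped Real Nat

/-- The zeta value `∑ 1 / j ^ k`. -/
noncomputable def zetaSum (k : ℕ) : ℝ := ∑' j : ℕ, (1 : ℝ) / ((j : ℝ) + 1) ^ k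

theorem hasSum_zetaSum {k : ℕ} (hk : 1 < k) :
    HasSum (fun j : ℕ => (1 : ℝ) / ((j : ℝ) + 1) ^ k) (zetaSum k) := by
  have h := (summable_nat_add_iff 1).2 (Real.summable_one_div_nat_pow.2 hk)
  simp only [Nat.cast_add, Nat.cast_one] at h
  exact h.hasSum

theorem zetaSum_two : zetaSum 2 = π ^ 2 / 6 := by
  have h := (hasSum_nat_add_iff' 1).2 hasSum_zeta_two
  simp at h
  exact (hasSum_zetaSum (by norm_num)).unique (by simpa using h)

theorem norm_log_one_add_sub_cubic_le {z : ℂ} (hz : ‖z‖ ≤ 1 / 2) :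
    ‖log (1 + z) - (z - z ^ 2 / 2 + z ^ 3 / 3)‖ ≤ ‖z‖ ^ 4 := by
  have h := norm_log_sub_logTaylor_le 3 (z := z) (by linarith)
  have h1 : logTaylor (3 + 1) z = z - z ^ 2 / 2 + z ^ 3 / 3 := by
    simp [logTaylor_succ, logTaylor_zero]; ring
  rw [h1] at h
  refine h.trans ?_
  have h2 : (1 - ‖z‖)⁻¹ ≤ 2 := by
    rw [show (2 : ℝ) = (1 / 2)⁻¹ by norm_num]
    exact inv_anti₀ (by norm_num) (by linarith)
  calc ‖z‖ ^ (3 + 1) * (1 - ‖z‖)⁻¹ / ((3 : ℕ) + 1) ≤ ‖z‖ ^ (3 + 1) * 2 / ((3 : ℕ) + 1) := by gcongr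
    _ ≤ ‖z‖ ^ 4 := by norm_num; nlinarith [pow_nonneg (norm_nonneg z) 4]

theorem hasCubicJet_log_one_add_div (j : ℕ) :
    HasCubicJet (fun s => log (1 + s / (j + 1))) 0 (1 / (j + 1)) (-(1 / (2 * (j + 1) ^ 2)))
      (1 / (3 * (j + 1) ^ 3)) := by
  refine IsBigO.of_bound 1 ?_
  filter_upwards [Metric.closedBall_mem_nhds (0 : ℂ) (by norm_num : (0 : ℝ) < 1 / 2)] with s hs
  have hj : (0 : ℝ) ≤ j := j.cast_nonneg
  have hn : ‖(j : ℂ) + 1‖ = j + 1 := by exact_mod_cast Complex.norm_natCast (j + 1)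
  have hj0 : (j : ℂ) + 1 ≠ 0 := by exact_mod_cast Nat.succ_ne_zero j
  have h1 : ‖s / (j + 1)‖ ≤ ‖s‖ := by
    rw [norm_div, hn]; exact div_le_self (norm_nonneg _) (by linarith)
  have hs' : ‖s‖ ≤ 1 / 2 := by simpa using hs
  have h2 := norm_log_one_add_sub_cubic_le (h1.trans hs')
  rw [one_mul, norm_pow]
  refine le_trans (le_of_eq ?_) (h2.trans (by gcongr))
  congr 1
  field_simp
  ring

/-- The series for `log Γ(1 + s)` near `0`. -/
noncomputable def logGammaSeries (s : ℂ) : ℂ :=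
  -Real.eulerMascheroniConstant * s + ∑' j : ℕ, (s / (j + 1) - log (1 + s / (j + 1)))

theorem norm_div_succ_le {s : ℂ} (j : ℕ) : ‖s / (j + 1)‖ = ‖s‖ * (1 / (j + 1)) := by
  have hn : ‖(j : ℂ) + 1‖ = j + 1 := by exact_mod_cast Complex.norm_natCast (j + 1)
  rw [norm_div, hn]; ring

theorem norm_div_succ_le_half {s : ℂ} (hs : ‖s‖ ≤ 1 / 2) (j : ℕ) : ‖s / (j + 1)‖ ≤ 1 / 2 := by
  have hj : (0 : ℝ) ≤ j := j.cast_nonneg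
  rw [norm_div_succ_le, mul_one_div]
  exact (div_le_self (norm_nonneg _) (by linarith)).trans hs

theorem hasSum_logGammaSeries {s : ℂ} (hs : ‖s‖ ≤ 1 / 2) :
    Summable (fun j : ℕ => s / (j + 1) - log (1 + s / (j + 1))) ∧
    ‖∑' j : ℕ, (s / (j + 1) - log (1 + s / (j + 1))) -
      (zetaSum 2 / 2 * s ^ 2 - zetaSum 3 / 3 * s ^ 3)‖ ≤ ‖s‖ ^ 4 * zetaSum 4 := by
  have hz : ∀ k : ℕ, 1 < k → HasSum (fun j : ℕ => (1 : ℂ) / ((j : ℂ) + 1) ^ k) (zetaSum k) := by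
    intro k hk
    have := Complex.hasSum_ofReal.2 (hasSum_zetaSum hk)
    push_cast at this
    exact this
  have hb : HasSum (fun j : ℕ => ‖s‖ ^ 4 * (1 / ((j : ℝ) + 1) ^ 4)) (‖s‖ ^ 4 * zetaSum 4) :=
    (hasSum_zetaSum (by norm_num)).mul_left _
  set R : ℕ → ℂ := fun j => -(log (1 + s / (j + 1)) -
    (s / (j + 1) - (s / (j + 1)) ^ 2 / 2 + (s / (j + 1)) ^ 3 / 3)) with hR
  have hRb : ∀ j, ‖R j‖ ≤ ‖s‖ ^ 4 * (1 / ((j : ℝ) + 1) ^ 4) := by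
    intro j
    rw [hR, norm_neg]
    refine (norm_log_one_add_sub_cubic_le (norm_div_succ_le_half hs j)).trans (le_of_eq ?_)
    rw [norm_div_succ_le, mul_pow, one_div_pow]
  have hRs : Summable R := Summable.of_norm_bounded hb.summable hRb
  have hQ : HasSum (fun j : ℕ => s ^ 2 / 2 * (1 / ((j : ℂ) + 1) ^ 2) -
      s ^ 3 / 3 * (1 / ((j : ℂ) + 1) ^ 3)) (s ^ 2 / 2 * zetaSum 2 - s ^ 3 / 3 * zetaSum 3) :=
    ((hz 2 (by norm_num)).mul_left _).sub ((hz 3 (by norm_num)).mul_left _)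
  have hT := hRs.hasSum.add hQ
  have heq : (fun j : ℕ => R j + (s ^ 2 / 2 * (1 / ((j : ℂ) + 1) ^ 2) -
      s ^ 3 / 3 * (1 / ((j : ℂ) + 1) ^ 3))) = fun j : ℕ => s / (j + 1) - log (1 + s / (j + 1)) := by
    ext j
    have hj0 : (j : ℂ) + 1 ≠ 0 := by exact_mod_cast Nat.succ_ne_zero j
    simp only [hR]
    field_simp
    ring
  rw [heq] at hT
  refine ⟨hT.summable, ?_⟩
  rw [hT.tsum_eq]
  refine le_trans (le_of_eq ?_) (tsum_of_norm_bounded hb hRb)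
  congr 1
  ring

theorem hasCubicJet_logGammaSeries :
    HasCubicJet logGammaSeries 0 (-Real.eulerMascheroniConstant) (zetaSum 2 / 2)
      (-(zetaSum 3 / 3)) := by
  refine IsBigO.of_bound (zetaSum 4) ?_
  filter_upwards [Metric.closedBall_mem_nhds (0 : ℂ) (by norm_num : (0 : ℝ) < 1 / 2)] with s hs
  have h := (hasSum_logGammaSeries (s := s) (by simpa using hs)).2
  rw [norm_pow, mul_comm (zetaSum 4)]
  refine le_trans (le_of_eq ?_) h
  congr 1
  rw [logGammaSeries]
  ring

theorem one_add_ne_zero_of_norm_le {z : ℂ} (hz : ‖z‖ ≤ 1 / 2) : 1 + z ≠ 0 := fun h => by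
  have : z = -1 := by linear_combination h
  rw [this] at hz
  norm_num at hz

theorem mul_GammaSeq_eq {s : ℂ} (hs : ‖s‖ ≤ 1 / 2) (hs0 : s ≠ 0) {n : ℕ} (hn : n ≠ 0) :
    s * GammaSeq s n = exp (-(((harmonic n : ℝ) - Real.log n : ℝ) : ℂ) * s +
      ∑ j ∈ Finset.range n, (s / (j + 1) - log (1 + s / (j + 1)))) := by
  have hprod : ∏ j ∈ Finset.range n, (s + ((j + 1 : ℕ) : ℂ)) =
      n ! * ∏ j ∈ Finset.range n, (1 + s / (j + 1)) := by
    rw [← Finset.prod_range_add_one_eq_factorial, Nat.cast_prod, ← Finset.prod_mul_distrib]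
    refine Finset.prod_congr rfl fun j _ => ?_
    have hj0 : (j : ℂ) + 1 ≠ 0 := by exact_mod_cast Nat.succ_ne_zero j
    push_cast
    field_simp
    ring
  have hexp : ∏ j ∈ Finset.range n, (1 + s / (j + 1)) =
      exp (∑ j ∈ Finset.range n, log (1 + s / (j + 1))) := by
    rw [exp_sum]
    refine Finset.prod_congr rfl fun j _ => ?_
    rw [exp_log (one_add_ne_zero_of_norm_le (norm_div_succ_le_half hs j))]
  have hn0 : (n : ℂ) ≠ 0 := by exact_mod_cast hn
  have hf0 : (n ! : ℂ) ≠ 0 := by exact_mod_cast n.factorial_ne_zero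
  rw [GammaSeq, Finset.prod_range_succ', hprod, hexp, cpow_def_of_ne_zero hn0, Finset.sum_sub_distrib,
    ← natCast_log]
  have hH : ∑ j ∈ Finset.range n, s / ((j : ℂ) + 1) = ((harmonic n : ℝ) : ℂ) * s := by
    rw [harmonic]
    push_cast
    rw [Finset.sum_mul]
    refine Finset.sum_congr rfl fun j _ => ?_
    rw [div_eq_inv_mul]
  rw [hH]
  have : -(((harmonic n : ℝ) - Real.log n : ℝ) : ℂ) * s + (((harmonic n : ℝ) : ℂ) * s -
      ∑ j ∈ Finset.range n, log (1 + s / (j + 1))) = ((Real.log n : ℝ) : ℂ) * s -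
        ∑ j ∈ Finset.range n, log (1 + s / (j + 1)) := by
    push_cast; ring
  rw [this, exp_sub, Nat.cast_zero, add_zero]
  have := exp_ne_zero (∑ j ∈ Finset.range n, log (1 + s / (j + 1)))
  field_simp

theorem Gamma_one_add_eq_exp {s : ℂ} (hs : ‖s‖ ≤ 1 / 2) : Gamma (1 + s) = exp (logGammaSeries s) := by
  rcases eq_or_ne s 0 with rfl | hs0
  · simp [logGammaSeries]
  rw [add_comm, Gamma_add_one s hs0]
  have h1 : Tendsto (fun n => s * GammaSeq s n) atTop (𝓝 (s * Gamma s)) :=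
    (GammaSeq_tendsto_Gamma s).const_mul s
  refine tendsto_nhds_unique h1 ?_
  have h2 := (hasSum_logGammaSeries hs).1.hasSum.tendsto_sum_nat
  have h3 := (Complex.continuous_ofReal.tendsto _).comp Real.tendsto_harmonic_sub_log
  have h4 : Tendsto (fun n : ℕ => exp (-(((harmonic n : ℝ) - Real.log n : ℝ) : ℂ) * s +
      ∑ j ∈ Finset.range n, (s / (j + 1) - log (1 + s / (j + 1))))) atTop
      (𝓝 (exp (logGammaSeries s))) :=
    (continuous_exp.tendsto _).comp ((h3.neg.mul_const s).add h2)
  refine h4.congr' ?_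
  filter_upwards [eventually_ne_atTop 0] with n hn
  exact (mul_GammaSeq_eq hs hs0 hn).symm

end LogGamma

section Approximation

open Complex Filter Topology Asymptotics
open scoped Real Nat

theorem Gamma_natCast_add_add_one {s : ℂ} (hs : ‖s‖ ≤ 1 / 2) (m : ℕ) :
    Gamma (m + s + 1) =
      m ! * exp (∑ j ∈ Finset.range m, log (1 + s / (j + 1)) + logGammaSeries s) := by
  induction m with
  | zero => simp [← Gamma_one_add_eq_exp hs, add_comm]
  | succ m ih =>
    have hj0 : (m : ℂ) + 1 ≠ 0 := by exact_mod_cast Nat.succ_ne_zero m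
    have h1 := one_add_ne_zero_of_norm_le (norm_div_succ_le_half hs m)
    have h2 : (m : ℂ) + s + 1 = (m + 1) * (1 + s / (m + 1)) := by field_simp; ring
    have h3 : ((m + 1 : ℕ) : ℂ) + s + 1 = (m + s + 1) + 1 := by push_cast; ring
    rw [h3, Gamma_add_one _ (by rw [h2]; exact mul_ne_zero hj0 h1), ih, Finset.sum_range_succ,
      h2, Nat.factorial_succ]
    rw [show ∑ j ∈ Finset.range m, log (1 + s / (j + 1)) + log (1 + s / (m + 1)) +
      logGammaSeries s = log (1 + s / (m + 1)) + (∑ j ∈ Finset.range m, log (1 + s / (j + 1)) +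
        logGammaSeries s) by ring, exp_add (log _), exp_log h1]
    push_cast
    ring

/-- The function multiplying `gammaTerm` to give elementary Taylor coefficients. -/
noncomputable def gammaFactor (a : ℕ) (s : ℂ) : ℂ :=
  exp (a * logGammaSeries s + (a - 1) * logGammaSeries (-s))

theorem gammaTerm_mul_gammaFactor {a n m : ℕ} (ha : 1 ≤ a) (hm : m ≤ n) {s : ℂ}
    (hs : ‖s‖ ≤ 1 / 2) :
    gammaTerm a n (m + s) * gammaFactor a s =
      (n ! : ℂ) ^ (a - 1) * (m ! : ℂ)⁻¹ ^ a * ((n - m)! : ℂ)⁻¹ ^ (a - 1) *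
        exp (-a * ∑ j ∈ Finset.range m, log (1 + s / (j + 1)) +
          -(a - 1) * ∑ j ∈ Finset.range (n - m), log (1 + -s / (j + 1))) := by
  have h1 := Gamma_natCast_add_add_one hs m
  have h2 := Gamma_natCast_add_add_one (s := -s) (by rwa [norm_neg]) (n - m)
  have h3 : (n : ℂ) + 1 - (m + s) = ((n - m : ℕ) : ℂ) + -s + 1 := by
    rw [Nat.cast_sub hm]; ring
  have ha1 : ((a - 1 : ℕ) : ℂ) = a - 1 := by rw [Nat.cast_sub ha]; simp
  rw [gammaTerm, h3, h1, h2, gammaFactor]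
  set A := ∑ j ∈ Finset.range m, log (1 + s / (j + 1))
  set B := ∑ j ∈ Finset.range (n - m), log (1 + -s / (j + 1))
  rw [mul_inv, mul_inv, mul_pow, mul_pow, ← exp_neg, ← exp_neg, ← exp_nat_mul, ← exp_nat_mul, ha1]
  have h4 : exp (-a * A + -(a - 1) * B) = exp (a * -(A + logGammaSeries s)) *
      exp ((a - 1) * -(B + logGammaSeries (-s))) *
      exp (a * logGammaSeries s + (a - 1) * logGammaSeries (-s)) := by
    rw [← exp_add, ← exp_add]; ring_nf
  rw [h4]
  ring

theorem hasCubicJet_sum_log (m : ℕ) :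
    HasCubicJet (fun s => ∑ j ∈ Finset.range m, log (1 + s / (j + 1))) 0 ((harmonic m : ℚ) : ℂ)
      (-((genHarmonic 2 m : ℚ) : ℂ) / 2) (((genHarmonic 3 m : ℚ) : ℂ) / 3) := by
  refine (HasCubicJet.sum fun j _ => hasCubicJet_log_one_add_div j).congr_coeff (by simp) ?_ ?_ ?_
  · simp [harmonic]
  · simp only [genHarmonic]
    push_cast
    rw [← Finset.sum_neg_distrib, Finset.sum_div]
    refine Finset.sum_congr rfl fun j _ => ?_
    have hj0 : (j : ℂ) + 1 ≠ 0 := by exact_mod_cast Nat.succ_ne_zero j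
    field_simp
  · simp only [genHarmonic]
    push_cast
    rw [Finset.sum_div]
    refine Finset.sum_congr rfl fun j _ => ?_
    have hj0 : (j : ℂ) + 1 ≠ 0 := by exact_mod_cast Nat.succ_ne_zero j
    field_simp

theorem choose_pow_mul_factorial {a n m : ℕ} (ha : 1 ≤ a) (hm : m ≤ n) :
    (n ! : ℂ) * ((n ! : ℂ) ^ (a - 1) * (m ! : ℂ)⁻¹ ^ a * ((n - m)! : ℂ)⁻¹ ^ (a - 1)) =
      (n.choose m : ℂ) ^ a * ((n - m)! : ℂ) := by
  obtain ⟨b, rfl⟩ : ∃ b, a = b + 1 := ⟨a - 1, by omega⟩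
  have h1 : (m ! : ℂ) ≠ 0 := by exact_mod_cast m.factorial_ne_zero
  have h2 : ((n - m)! : ℂ) ≠ 0 := by exact_mod_cast (n - m).factorial_ne_zero
  rw [Nat.cast_choose ℂ hm, Nat.add_sub_cancel, div_pow, mul_pow,
    inv_pow, inv_pow]
  field_simp
  ring

theorem hasCubicJet_gammaTerm_mul {a n m : ℕ} (ha : 1 ≤ a) (hm : m ≤ n) :
    HasCubicJet (fun s => n ! * (gammaTerm a n (m + s) * gammaFactor a s))
      ((n.choose m : ℂ) ^ a * ((n - m)! : ℂ))
      ((n.choose m : ℂ) ^ a * ((n - m)! : ℂ) * -(r1 a n (n - m) : ℚ))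
      ((n.choose m : ℂ) ^ a * ((n - m)! : ℂ) *
        (((r1 a n (n - m) : ℚ) : ℂ) ^ 2 / 2 + (r2 a n (n - m) : ℚ) / 2))
      ((n.choose m : ℂ) ^ a * ((n - m)! : ℂ) *
        -((((r1 a n (n - m) : ℚ) : ℂ) ^ 3 + 3 * (r1 a n (n - m) : ℚ) * (r2 a n (n - m) : ℚ) +
          (r3 a n (n - m) : ℚ)) / 6)) := by
  have hnm : n - (n - m) = m := by omega
  have h1 := ((hasCubicJet_sum_log m).const_mul (-a)).add
    ((hasCubicJet_sum_log (n - m)).comp_neg.const_mul (-(a - 1)))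
  have h2 : HasCubicJet (fun s => -a * ∑ j ∈ Finset.range m, log (1 + s / (j + 1)) +
          -(a - 1) * ∑ j ∈ Finset.range (n - m), log (1 + -s / (j + 1))) 0
      (-(r1 a n (n - m) : ℚ)) ((r2 a n (n - m) : ℚ) / 2) (-((r3 a n (n - m) : ℚ) / 6)) := by
    refine h1.congr_coeff (by ring) ?_ ?_ ?_
    · rw [r1, hnm]; push_cast; ring
    · rw [r2, hnm]; push_cast; ring
    · rw [r3, hnm]; push_cast; ring
  have h3 := h2.exp.const_mul ((n.choose m : ℂ) ^ a * ((n - m)! : ℂ))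
  refine HasCubicJet.congr (h3.congr_coeff (by ring) (by ring) (by ring) (by ring)) ?_
  filter_upwards [Metric.closedBall_mem_nhds (0 : ℂ) (by norm_num : (0 : ℝ) < 1 / 2)] with s hs
  rw [gammaTerm_mul_gammaFactor ha hm (by simpa using hs), ← choose_pow_mul_factorial ha hm]
  ring

theorem hasCubicJet_gammaSum_mul {a n : ℕ} (ha : 1 ≤ a) :
    ∃ c₁ c₂ : ℂ, HasCubicJet (fun s => n ! * (gammaSum a n s * gammaFactor a s))
      (qseq a n : ℚ) c₁ c₂ (-((pseq3 a n : ℚ) / 6)) := by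
  have h := HasCubicJet.sum (t := Finset.range (n + 1)) fun m hm =>
    hasCubicJet_gammaTerm_mul (a := a) (n := n) ha (Nat.lt_succ_iff.1 (Finset.mem_range.1 hm))
  refine ⟨_, _, HasCubicJet.congr (h.congr_coeff ?_ rfl rfl ?_) ?_⟩
  · rw [qseq, ← Finset.sum_range_reflect]
    push_cast
    refine Finset.sum_congr rfl fun m hm => ?_
    have hm' := Nat.lt_succ_iff.1 (Finset.mem_range.1 hm)
    rw [Nat.sub_sub_self hm', Nat.choose_symm hm']
  · rw [pseq3, ← Finset.sum_range_reflect]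
    push_cast
    rw [Finset.sum_div, ← Finset.sum_neg_distrib]
    refine Finset.sum_congr rfl fun m hm => ?_
    have hm' := Nat.lt_succ_iff.1 (Finset.mem_range.1 hm)
    rw [Nat.sub_sub_self hm', Nat.choose_symm hm']
    ring
  · refine Eventually.of_forall fun s => ?_
    simp only [gammaSum]
    rw [Finset.sum_mul, Finset.mul_sum]

theorem hasCubicJet_gammaFactor (a : ℕ) :
    ∃ c₂ : ℂ, HasCubicJet (gammaFactor a) 1 (-Real.eulerMascheroniConstant) c₂
      (-((Real.eulerMascheroniConstant ^ 3 +
          (6 * (a : ℝ) - 3) * Real.eulerMascheroniConstant * Real.pi ^ 2 / 6 +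
          2 * zetaSum 3 : ℝ) : ℂ) / 6) := by
  have h := ((hasCubicJet_logGammaSeries.const_mul a).add
    (hasCubicJet_logGammaSeries.comp_neg.const_mul (a - 1)))
  have h2 := (h.congr_coeff (d₀ := 0) (by ring) rfl rfl rfl).exp
  refine ⟨_, h2.congr_coeff rfl (by ring) rfl ?_⟩
  rw [zetaSum_two]
  push_cast
  ring

/-- A bound for the oscillation of `gammaSum` near `0` controls the error of the approximation. -/
theorem exists_abs_sub_le_of_norm_gammaSum_sub_le {a : ℕ} (ha : 1 ≤ a) :
    ∃ C : ℝ, 0 < C ∧ ∀ (n : ℕ) (B : ℝ),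
      (∀ s : ℂ, ‖s‖ ≤ 1 / 4 → ‖gammaSum a n s - gammaSum a n 0‖ ≤ B) →
      |(Real.eulerMascheroniConstant ^ 3 +
          (6 * (a : ℝ) - 3) * Real.eulerMascheroniConstant * Real.pi ^ 2 / 6 +
          2 * zetaSum 3) * (qseq a n : ℝ) - pseq3 a n| ≤ C * n ! * B := by
  obtain ⟨c₂, hc⟩ := hasCubicJet_gammaFactor a
  set K := (Real.eulerMascheroniConstant ^ 3 +
          (6 * (a : ℝ) - 3) * Real.eulerMascheroniConstant * Real.pi ^ 2 / 6 +
          2 * zetaSum 3)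
  set γ := Real.eulerMascheroniConstant
  refine ⟨384 * (‖c₂‖ + |γ| + 1), by positivity, fun n B hB => ?_⟩
  obtain ⟨d₁, d₂, hd⟩ := hasCubicJet_gammaSum_mul (n := n) ha
  obtain ⟨h₀, h₁, h₂, h₃, hh, -, b1, b2, b3⟩ := exists_hasCubicJet_of_norm_le
    ((differentiable_gammaSum a n).sub_const (gammaSum a n 0)) hB
  have hS := (((hh.add (hasCubicJet_const (gammaSum a n 0))).mul hc).const_mul (n ! : ℂ))
  have hS' := hS.congr (g := fun s => n ! * (gammaSum a n s * gammaFactor a s))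
    (Eventually.of_forall fun s => by ring)
  obtain ⟨e0, -, -, e3⟩ := hd.coeff_unique hS'
  have key : ((K * (qseq a n : ℝ) - pseq3 a n : ℝ) : ℂ) =
      6 * (n ! * (h₁ * c₂ + h₂ * -γ + h₃)) := by
    push_cast
    linear_combination 6 * e3 - (-K / 6) * 6 * e0
  rw [← Real.norm_eq_abs, ← Complex.norm_real, key]
  rw [norm_mul, norm_mul, Complex.norm_natCast]
  have hγ : ‖(-γ : ℂ)‖ = |γ| := by simp
  have h6 : ‖(6 : ℂ)‖ = 6 := by norm_num
  have : ‖h₁ * c₂ + h₂ * -γ + h₃‖ ≤ (64 * B) * ‖c₂‖ + (64 * B) * |γ| + 64 * B := by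
    refine (norm_add₃_le).trans ?_
    rw [norm_mul, norm_mul, hγ]
    gcongr
  rw [h6]
  calc 6 * (n ! * ‖h₁ * c₂ + h₂ * -γ + h₃‖)
      ≤ 6 * (n ! * ((64 * B) * ‖c₂‖ + (64 * B) * |γ| + 64 * B)) := by gcongr
    _ = _ := by ring

end Approximation

section Asymptotics

open Filter Topology
open scoped Nat

theorem log_sub_two_mul_div_le_log_sub {n m : ℝ} (hm : 0 ≤ m) (hn : 0 < n) (hmn : 2 * m ≤ n) :
    Real.log n - 2 * m / n ≤ Real.log (n - m) := by
  have h1 : 0 < n - m := by linarith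
  have h2 := Real.one_sub_inv_le_log_of_pos (div_pos h1 hn)
  rw [Real.log_div h1.ne' hn.ne', inv_div] at h2
  have h3 : n / (n - m) ≤ 1 + 2 * m / n := by
    rw [div_le_iff₀ h1, one_add_div hn.ne', div_mul_eq_mul_div, le_div_iff₀ hn]
    nlinarith
  linarith

theorem factorial_mul_exp_le_qseq {a n : ℕ} {N : ℝ} (ha : 1 ≤ a) (hn : 1 ≤ n) (hN : 1 ≤ N)
    (hNn : 2 * N ≤ n) (hNlog : a * Real.log N = (a - 1) * Real.log n) :
    n ! * Real.exp (a * N - 2 * a - a * Real.log n - 2 * a * (N ^ 2 / n)) ≤ (qseq a n : ℝ) := by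
  set m := ⌊N⌋₊ with hm
  have hm1 : 1 ≤ m := Nat.le_floor (by simpa using hN)
  have hmN : (m : ℝ) ≤ N := Nat.floor_le (by linarith)
  have hNm : N < m + 1 := Nat.lt_floor_add_one N
  have hn0 : (0 : ℝ) < n := by exact_mod_cast hn
  have hm0 : (1 : ℝ) ≤ m := by exact_mod_cast hm1
  have ha0 : (1 : ℝ) ≤ a := by exact_mod_cast ha
  have hmnR : (m : ℝ) ≤ n := by linarith
  have hmn : m ≤ n := by exact_mod_cast hmnR
  have hterm : (n.choose m : ℝ) ^ a * (n - m)! ≤ (qseq a n : ℝ) := by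
    rw [qseq]
    push_cast
    have := Finset.single_le_sum (f := fun k => (n.choose k : ℝ) ^ a * (k ! : ℝ))
      (fun k _ => by positivity) (Finset.mem_range.2 (by omega : n - m < n + 1))
    simpa [Nat.choose_symm hmn] using this
  refine le_trans ?_ hterm
  have hchoose : (n.choose m : ℝ) * m ! * (n - m)! = n ! := by
    exact_mod_cast Nat.choose_mul_factorial_mul_factorial hmn
  have hdesc : ((n : ℝ) - m) ^ m ≤ n.choose m * m ! := by
    have h := Nat.pow_sub_le_descFactorial n m
    rw [Nat.descFactorial_eq_factorial_mul_choose, mul_comm] at h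
    have h' : (((n + 1 - m : ℕ) : ℝ)) ^ m ≤ n.choose m * m ! := by exact_mod_cast h
    refine le_trans (pow_le_pow_left₀ (by linarith) ?_ m) h'
    rw [Nat.cast_sub (by omega)]
    push_cast
    linarith
  have hnm0 : (0 : ℝ) < n - m := by linarith
  have hlogf := log_factorial_le hm1
  have hmf : (0 : ℝ) < m ! := by exact_mod_cast m.factorial_pos
  have hlogm : Real.log m ≤ Real.log N := Real.log_le_log (by linarith) hmN
  have hlogn : Real.log m ≤ Real.log n := Real.log_le_log (by linarith) hmnR
  have hlogs := log_sub_two_mul_div_le_log_sub (n := n) (m := m) (by linarith) hn0 (by linarith)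
  set X := a * N - 2 * a - a * Real.log n - 2 * a * (N ^ 2 / n) with hX
  have hexp : X + a * Real.log (m !) ≤ (a - 1) * (m * Real.log (n - m)) := by
    have e1 : (a : ℝ) * Real.log (m !) ≤ a * (m * Real.log m - m + Real.log m + 1) := by gcongr
    have e2 : ((a : ℝ) - 1) * (m * (Real.log n - 2 * m / n)) ≤
        (a - 1) * (m * Real.log (n - m)) := by
      have : (0 : ℝ) ≤ a - 1 := by linarith
      gcongr
    have e3 : ((a : ℝ) - 1) * (m * (Real.log n - 2 * m / n)) =
        m * (a * Real.log N) - 2 * (a - 1) * (m ^ 2 / n) := by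
      rw [hNlog]; ring
    have e4 : 2 * ((a : ℝ) - 1) * (m ^ 2 / n) ≤ 2 * a * (N ^ 2 / n) := by
      gcongr
      linarith
    have e5 : m * (a * Real.log m) ≤ m * (a * Real.log N) := by gcongr
    have e6 : a * Real.log m ≤ a * Real.log n := by gcongr
    have e7 : a * N ≤ a * (m + 1) := by gcongr
    linarith
  have hpow : Real.exp X * (m ! : ℝ) ^ a ≤ (n.choose m * m !) ^ (a - 1) := by
    calc Real.exp X * (m ! : ℝ) ^ a = Real.exp (X + a * Real.log (m !)) := by
          rw [Real.exp_add, Real.exp_nat_mul, Real.exp_log hmf]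
      _ ≤ Real.exp ((a - 1 : ℕ) * (m * Real.log (n - m))) := by
          rw [Nat.cast_sub ha]; exact Real.exp_le_exp.2 (by simpa using hexp)
      _ = (((n : ℝ) - m) ^ m) ^ (a - 1) := by
          rw [Real.exp_nat_mul, Real.exp_nat_mul, Real.exp_log hnm0]
      _ ≤ _ := by gcongr
  obtain ⟨b, rfl⟩ : ∃ b, a = b + 1 := ⟨a - 1, by omega⟩
  rw [Nat.add_sub_cancel, mul_pow, pow_succ, ← mul_assoc, mul_right_comm] at hpow
  have hpow' := le_of_mul_le_mul_right hpow (by positivity)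
  calc (n ! : ℝ) * Real.exp X = (Real.exp X * m !) * (n.choose m * (n - m)!) := by
        rw [← hchoose]; ring
    _ ≤ (n.choose m : ℝ) ^ b * (n.choose m * (n - m)!) := by gcongr
    _ = _ := by ring

theorem eventually_log_add_le {c A D E ε : ℝ} (hc : 0 < c) (hc1 : c < 1) (hε : 0 < ε) :
    ∀ᶠ n : ℕ in atTop,
      A * Real.log n + D + E * (((n : ℝ) ^ c) ^ 2 / n) ≤ ε * (n : ℝ) ^ c := by
  have hN : Tendsto (fun n : ℕ => (n : ℝ) ^ c) atTop atTop :=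
    (tendsto_rpow_atTop hc).comp tendsto_natCast_atTop_atTop
  have h1 : Tendsto (fun n : ℕ => Real.log n / (n : ℝ) ^ c) atTop (𝓝 0) :=
    (isLittleO_log_rpow_atTop hc).tendsto_div_nhds_zero.comp tendsto_natCast_atTop_atTop
  have h2 : Tendsto (fun n : ℕ => D / (n : ℝ) ^ c) atTop (𝓝 0) := hN.const_div_atTop D
  have h3 : Tendsto (fun n : ℕ => (n : ℝ) ^ (-(1 - c))) atTop (𝓝 0) :=
    (tendsto_rpow_neg_atTop (by linarith)).comp tendsto_natCast_atTop_atTop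
  have h := ((h1.const_mul A).add h2).add (h3.const_mul E)
  simp only [mul_zero, add_zero] at h
  filter_upwards [h.eventually_lt_const hε, eventually_ge_atTop 1] with n hn hn1
  have hn0 : (0 : ℝ) < n := by exact_mod_cast hn1
  have hNpos : 0 < (n : ℝ) ^ c := Real.rpow_pos_of_pos hn0 c
  have h4 : (n : ℝ) ^ (-(1 - c)) = (n : ℝ) ^ c / n := by
    rw [show -(1 - c) = c - 1 by ring, Real.rpow_sub_one hn0.ne']
  rw [h4] at hn
  have := mul_le_mul_of_nonneg_right hn.le hNpos.le
  refine le_trans (le_of_eq ?_) this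
  field_simp

end Asymptotics

open Filter Topology
open scoped Nat

theorem stmt_2 (a : ℕ) (ha : 4 ≤ a) :
    ∀ ε : ℝ, 0 < ε → ∃ N : ℕ, ∀ n : ℕ, N ≤ n →
      |Real.eulerMascheroniConstant ^ 3 +
          (6 * (a : ℝ) - 3) * Real.eulerMascheroniConstant * Real.pi ^ 2 / 6 +
          2 * (∑' j : ℕ, (1 : ℝ) / ((j : ℝ) + 1) ^ 3) -
          (pseq3 a n : ℝ) / (qseq a n : ℝ)| ≤
        Real.exp (((a : ℝ) * (Real.cos (2 * Real.pi / (a : ℝ)) - 1) + ε) *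
          (n : ℝ) ^ ((1 : ℝ) - 1 / (a : ℝ))) := by
  intro ε hε
  obtain ⟨C, hC, hCB⟩ := exists_abs_sub_le_of_norm_gammaSum_sub_le (a := a) (by omega)
  set K := Real.eulerMascheroniConstant ^ 3 +
          (6 * (a : ℝ) - 3) * Real.eulerMascheroniConstant * Real.pi ^ 2 / 6 +
          2 * (∑' j : ℕ, (1 : ℝ) / ((j : ℝ) + 1) ^ 3)
  have hCB' : ∀ (n : ℕ) (B : ℝ),
      (∀ s : ℂ, ‖s‖ ≤ 1 / 4 → ‖gammaSum a n s - gammaSum a n 0‖ ≤ B) →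
      |K * (qseq a n : ℝ) - pseq3 a n| ≤ C * n ! * B := hCB
  have ha4 : (4 : ℝ) ≤ a := by exact_mod_cast ha
  have ha0 : (0 : ℝ) < a := by linarith
  set θ := 2 * Real.pi / (a : ℝ) with hθ
  have hθa : a * θ = 2 * Real.pi := by rw [hθ]; field_simp
  have hθ0 : 0 < θ := by positivity
  have hsin : 0 < Real.sin θ := by
    refine Real.sin_pos_of_pos_of_lt_pi hθ0 ?_
    rw [hθ, div_lt_iff₀ ha0]
    nlinarith [Real.pi_pos]
  set c := (1 : ℝ) - 1 / (a : ℝ) with hc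
  have hinv : 1 / (a : ℝ) ≤ 1 / 4 := one_div_le_one_div_of_le (by norm_num) ha4
  have hinv0 : 0 < 1 / (a : ℝ) := by positivity
  have hc0 : 0 < c := by linarith
  have hc1 : c < 1 := by linarith
  set C' := C * (4 * (1 + Real.exp 2) * Real.exp 2) * 16 * 12 ^ (2 * a) * Real.exp (4 * a) with hC'
  have hC'0 : 0 < C' := by positivity
  have hNtop : Tendsto (fun n : ℕ => (n : ℝ) ^ c) atTop atTop :=
    (tendsto_rpow_atTop hc0).comp tendsto_natCast_atTop_atTop
  have hhalf : ∀ᶠ n : ℕ in atTop, 2 * (n : ℝ) ^ c ≤ n := by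
    have h : Tendsto (fun n : ℕ => (n : ℝ) ^ (1 - c)) atTop atTop :=
      (tendsto_rpow_atTop (by linarith)).comp tendsto_natCast_atTop_atTop
    filter_upwards [h.eventually_ge_atTop 2, eventually_ge_atTop 1] with n hn hn1
    have hn0 : (0 : ℝ) < n := by exact_mod_cast hn1
    calc 2 * (n : ℝ) ^ c ≤ (n : ℝ) ^ (1 - c) * (n : ℝ) ^ c := by gcongr
      _ = n := by rw [← Real.rpow_add hn0]; simp
  rw [← eventually_atTop]
  filter_upwards [eventually_ge_atTop 1, hhalf, hNtop.eventually_ge_atTop 1,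
    hNtop.eventually_ge_atTop (1 / Real.sin θ),
    (Real.tendsto_log_atTop.comp tendsto_natCast_atTop_atTop).eventually_ge_atTop (a : ℝ),
    eventually_log_add_le (A := 5 * a + 2) (D := Real.log C') (E := 4 * a) hc0 hc1 hε]
    with n hn1 hNn hN1 hNsin hna hfin
  have hn0 : (0 : ℝ) < n := by exact_mod_cast hn1
  have hn1' : (1 : ℝ) ≤ n := by exact_mod_cast hn1
  set N := (n : ℝ) ^ c with hN
  have hNlog : a * Real.log N = (a - 1) * Real.log n := by
    rw [hN, Real.log_rpow hn0, hc]; field_simp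
  have hq := factorial_mul_exp_le_qseq (a := a) (by omega) hn1 hN1 hNn hNlog
  have hnf : (0 : ℝ) < n ! := by exact_mod_cast n.factorial_pos
  have hq0 : (0 : ℝ) < qseq a n := lt_of_lt_of_le (by positivity) hq
  have hb := hCB' n _ fun s hs => norm_gammaSum_sub_le ha hn1 hna hN1 (by linarith) hNlog hθa
    ((div_le_iff₀ hsin).1 hNsin) hs
  have hsub : K - (pseq3 a n : ℝ) / (qseq a n : ℝ) =
      (K * (qseq a n : ℝ) - pseq3 a n) / qseq a n := by field_simp
  rw [hsub, abs_div, abs_of_pos hq0, div_le_iff₀ hq0]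
  refine hb.trans (le_trans ?_ (mul_le_mul_of_nonneg_left hq (Real.exp_pos _).le))
  have hsinN : 2 + 2 * (N * Real.sin θ) ≤ 4 * n := by
    nlinarith [Real.sin_le_one θ]
  have hpow : (n : ℝ) ^ (4 * a + 2) = Real.exp ((4 * a + 2) * Real.log n) := by
    rw [← Real.exp_log hn0, ← Real.exp_nat_mul, Real.log_exp]; push_cast; rfl
  calc C * n ! * (4 * (1 + Real.exp 2) * Real.exp 2 * (2 + 2 * (N * Real.sin θ)) *
        (2 * (n + 1) * (((12 * n) * n) ^ (2 * a) * Real.exp (2 * a * N ^ 2 / n + 2 * a) *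
          Real.exp (a * N * Real.cos θ))))
      ≤ C * n ! * (4 * (1 + Real.exp 2) * Real.exp 2 * (4 * n) *
        (2 * (n + n) * (((12 * n) * n) ^ (2 * a) * Real.exp (2 * a * N ^ 2 / n + 2 * a) *
          Real.exp (a * N * Real.cos θ)))) := by
        gcongr
    _ = n ! * Real.exp (Real.log C' + (4 * a + 2) * Real.log n + 2 * a * N ^ 2 / n - 2 * a +
          a * N * Real.cos θ) := by
        have hsplit : Real.exp (Real.log C' + (4 * a + 2) * Real.log n + 2 * a * N ^ 2 / n - 2 * a +
            a * N * Real.cos θ) * Real.exp (4 * a) = C' * n ^ (4 * a + 2) *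
              Real.exp (2 * a * N ^ 2 / n + 2 * a) * Real.exp (a * N * Real.cos θ) := by
          conv_rhs => rw [← Real.exp_log hC'0]
          rw [hpow, ← Real.exp_add, ← Real.exp_add, ← Real.exp_add, ← Real.exp_add]
          ring_nf
        refine mul_right_cancel₀ (Real.exp_ne_zero (4 * a)) ?_
        rw [mul_assoc (n ! : ℝ), hsplit, hC']
        ring
    _ ≤ n ! * Real.exp ((a * (Real.cos θ - 1) + ε) * N + (a * N - 2 * a - a * Real.log n -
          2 * a * (N ^ 2 / n))) := by
        refine mul_le_mul_of_nonneg_left (Real.exp_le_exp.2 ?_) hnf.le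
        rw [mul_div_assoc]
        linarith
    _ = _ := by rw [Real.exp_add]; ring
end

section
/- Let a ≥ 3 be an integer and n ∈ ℕ. Then D_n²·p_{n,2} is an integer, where D_n = lcm(1, 2, …, n). -/
/-- `D_n = lcm(1, 2, …, n)` (with `D_0 = 1`). -/
def Dlcm (n : ℕ) : ℕ := (Finset.Icc 1 n).lcm id

/-- `p_{n,2} = ∑_{k=0}^n C(n,k)^a · k! · (r_1(k)² + r_2(k))`. -/
noncomputable def pseq2 (a n : ℕ) : ℚ :=
  ∑ k ∈ Finset.range (n + 1), (n.choose k : ℚ) ^ a * (Nat.factorial k : ℚ) *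
    ((r1 a n k) ^ 2 + r2 a n k)

/-- For `j < n` the quotient `D_n / (j + 1)` is an integer. -/
theorem Dlcm_mul_one_div_mem {n j : ℕ} (hj : j < n) :
    (Dlcm n : ℚ) * (1 / ((j : ℚ) + 1)) ∈ (Int.castRingHom ℚ).range := by
  have hdvd : j + 1 ∣ Dlcm n :=
    Finset.dvd_lcm (f := id) (Finset.mem_Icc.mpr ⟨by omega, by omega⟩)
  obtain ⟨c, hc⟩ := hdvd
  refine ⟨(c : ℤ), ?_⟩
  have h0 : (j : ℚ) + 1 ≠ 0 := by positivity
  rw [hc]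
  push_cast
  simp only [eq_intCast, Int.cast_natCast]
  field_simp

theorem Dlcm_pow_mul_genHarmonic_mem (m : ℕ) {n k : ℕ} (hk : k ≤ n) :
    (Dlcm n : ℚ) ^ m * genHarmonic m k ∈ (Int.castRingHom ℚ).range := by
  rw [genHarmonic, Finset.mul_sum]
  refine sum_mem fun j hj => ?_
  have hj' : j < n := (Finset.mem_range.mp hj).trans_le hk
  have h := pow_mem (Dlcm_mul_one_div_mem hj') m
  rwa [mul_pow, one_div_pow] at h

theorem harmonic_eq_genHarmonic_one (k : ℕ) : harmonic k = genHarmonic 1 k := by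
  simp [harmonic, genHarmonic]

theorem Dlcm_mul_harmonic_mem {n k : ℕ} (hk : k ≤ n) :
    (Dlcm n : ℚ) * harmonic k ∈ (Int.castRingHom ℚ).range := by
  simpa only [pow_one, harmonic_eq_genHarmonic_one] using Dlcm_pow_mul_genHarmonic_mem 1 hk

theorem Dlcm_mul_r1_mem (a : ℕ) {n k : ℕ} (hk : k ≤ n) :
    (Dlcm n : ℚ) * r1 a n k ∈ (Int.castRingHom ℚ).range := by
  have h := sub_mem
    (mul_mem (natCast_mem _ a) (Dlcm_mul_harmonic_mem (Nat.sub_le n k)))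
    (mul_mem (sub_mem (natCast_mem _ a) (one_mem _)) (Dlcm_mul_harmonic_mem hk))
  convert h using 1
  rw [r1]
  ring

theorem Dlcm_sq_mul_r2_mem (a : ℕ) {n k : ℕ} (hk : k ≤ n) :
    (Dlcm n : ℚ) ^ 2 * r2 a n k ∈ (Int.castRingHom ℚ).range := by
  have h := add_mem
    (mul_mem (natCast_mem _ a) (Dlcm_pow_mul_genHarmonic_mem 2 (Nat.sub_le n k)))
    (mul_mem (sub_mem (natCast_mem _ a) (one_mem _)) (Dlcm_pow_mul_genHarmonic_mem 2 hk))
  convert h using 1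
  rw [r2]
  ring

theorem stmt_4 (a : ℕ) (ha : 3 ≤ a) (n : ℕ) :
    ∃ z : ℤ, (Dlcm n : ℚ) ^ 2 * pseq2 a n = (z : ℚ) := by
  have hmem : (Dlcm n : ℚ) ^ 2 * pseq2 a n ∈ (Int.castRingHom ℚ).range := by
    rw [pseq2, Finset.mul_sum]
    refine sum_mem fun k hk => ?_
    have hkn : k ≤ n := Nat.lt_succ_iff.mp (Finset.mem_range.mp hk)
    have h := mul_mem
      (mul_mem (pow_mem (natCast_mem _ (n.choose k)) a) (natCast_mem _ k.factorial))
      (add_mem (pow_mem (Dlcm_mul_r1_mem a hkn) 2) (Dlcm_sq_mul_r2_mem a hkn))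
    convert h using 1
    ring
  obtain ⟨z, hz⟩ := hmem
  exact ⟨z, hz.symm⟩
end

section
/- Let a ≥ 4 be an integer and n ∈ ℕ. Then D_n³·p_{n,3} is an integer, where D_n = lcm(1, 2, …, n). -/
/-- Every `j` with `1 ≤ j ≤ n` divides `D_n`. -/
theorem dvd_Dlcm {n j : ℕ} (hj : 1 ≤ j) (hjn : j ≤ n) : j ∣ Dlcm n :=
  Finset.dvd_lcm (f := id) (Finset.mem_Icc.2 ⟨hj, hjn⟩)

/-- `D_n^i · H_m^{(i)}` is an integer for `m ≤ n`. -/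
theorem Dlcm_pow_mul_genHarmonic_mem_range (i : ℕ) {m n : ℕ} (h : m ≤ n) :
    (Dlcm n : ℚ) ^ i * genHarmonic i m ∈ (Int.castRingHom ℚ).range := by
  rw [genHarmonic, Finset.mul_sum]
  refine sum_mem fun j hj => ?_
  obtain ⟨c, hc⟩ := dvd_Dlcm (Nat.succ_pos j) ((Finset.mem_range.1 hj).trans_le h)
  have hj0 : (j : ℚ) + 1 ≠ 0 := by positivity
  refine ⟨(c : ℤ) ^ i, ?_⟩
  rw [hc]
  push_cast
  simp only [map_pow, eq_intCast, Int.cast_natCast]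
  rw [mul_pow]
  field_simp

/-- `D_n · H_m` is an integer for `m ≤ n`. -/
theorem Dlcm_mul_harmonic_mem_range {m n : ℕ} (h : m ≤ n) :
    (Dlcm n : ℚ) * harmonic m ∈ (Int.castRingHom ℚ).range := by
  simpa [genHarmonic, harmonic] using Dlcm_pow_mul_genHarmonic_mem_range 1 h

theorem stmt_5 (a : ℕ) (ha : 4 ≤ a) (n : ℕ) :
    ∃ z : ℤ, (Dlcm n : ℚ) ^ 3 * pseq3 a n = (z : ℚ) := by
  suffices h : (Dlcm n : ℚ) ^ 3 * pseq3 a n ∈ (Int.castRingHom ℚ).range by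
    obtain ⟨z, hz⟩ := h
    exact ⟨z, hz.symm⟩
  rw [pseq3, Finset.mul_sum]
  refine sum_mem fun k hk => ?_
  have hkn : k ≤ n := Nat.lt_succ_iff.1 (Finset.mem_range.1 hk)
  have ha' := natCast_mem (Int.castRingHom ℚ).range a
  have ha1 := sub_mem ha' (one_mem _)
  have h1 : (Dlcm n : ℚ) * r1 a n k ∈ (Int.castRingHom ℚ).range := by
    convert sub_mem (mul_mem ha' (Dlcm_mul_harmonic_mem_range (n.sub_le k)))
      (mul_mem ha1 (Dlcm_mul_harmonic_mem_range hkn)) using 1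
    rw [r1]
    ring
  have h2 : (Dlcm n : ℚ) ^ 2 * r2 a n k ∈ (Int.castRingHom ℚ).range := by
    convert add_mem (mul_mem ha' (Dlcm_pow_mul_genHarmonic_mem_range 2 (n.sub_le k)))
      (mul_mem ha1 (Dlcm_pow_mul_genHarmonic_mem_range 2 hkn)) using 1
    rw [r2]
    ring
  have h3 : (Dlcm n : ℚ) ^ 3 * r3 a n k ∈ (Int.castRingHom ℚ).range := by
    convert mul_mem (natCast_mem _ 2)
      (sub_mem (mul_mem ha' (Dlcm_pow_mul_genHarmonic_mem_range 3 (n.sub_le k)))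
        (mul_mem ha1 (Dlcm_pow_mul_genHarmonic_mem_range 3 hkn))) using 1
    rw [r3]
    push_cast
    ring
  convert mul_mem
    (mul_mem (pow_mem (natCast_mem _ (n.choose k)) a) (natCast_mem _ k.factorial))
    (add_mem (add_mem (pow_mem h1 3) (mul_mem (mul_mem (natCast_mem _ 3) h1) h2)) h3) using 1
  push_cast
  ring
end

section
/- Let a = 3, q_n = ∑_{k=0}^n C(n,k)³·k! and p_{n,1} = ∑_{k=0}^n C(n,k)³·k!·(3H_{n−k} − 2H_k). Then both sequences f_n = q_n and f_n = p_{n,1} satisfy, for every integer n ≥ 2, the recurrence (n+1)(8n−9)·f_{n+1} = (24n³+13n²−32n−18)·f_n − n(24n³−75n²+52n−5)·f_{n−1} + n(n−1)³(8n−1)·f_{n−2}. -/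
/-- `q_n = ∑_{k=0}^n C(n,k)³ · k!`. -/
noncomputable def qseq3 (n : ℕ) : ℚ :=
  ∑ k ∈ Finset.range (n + 1), (n.choose k : ℚ) ^ 3 * (Nat.factorial k : ℚ)

/-- `p_{n,1} = ∑_{k=0}^n C(n,k)³ · k! · (3·H_{n-k} - 2·H_k)`. -/
noncomputable def pseq31 (n : ℕ) : ℚ :=
  ∑ k ∈ Finset.range (n + 1), (n.choose k : ℚ) ^ 3 * (Nat.factorial k : ℚ) *
    (3 * harmonic (n - k) - 2 * harmonic k)

/-- The homogeneous third-order recurrence from Example 1 (case `a = 3`). -/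
def Rec3 (f : ℕ → ℚ) : Prop :=
  ∀ n : ℕ, 2 ≤ n →
    ((n : ℚ) + 1) * (8 * (n : ℚ) - 9) * f (n + 1) =
      (24 * (n : ℚ) ^ 3 + 13 * (n : ℚ) ^ 2 - 32 * (n : ℚ) - 18) * f n -
        (n : ℚ) * (24 * (n : ℚ) ^ 3 - 75 * (n : ℚ) ^ 2 + 52 * (n : ℚ) - 5) * f (n - 1) +
        (n : ℚ) * ((n : ℚ) - 1) ^ 3 * (8 * (n : ℚ) - 1) * f (n - 2)

/-- The summand of `qseq3`. -/
def chooseCubeFactorial (n k : ℕ) : ℚ := (n.choose k : ℚ) ^ 3 * (k.factorial : ℚ)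

/-- The harmonic weight in the summand of `pseq31`. -/
def harmonicWeight (n k : ℕ) : ℚ := 3 * harmonic (n - k) - 2 * harmonic k

/-- The polynomial part of the Zeilberger certificate for the summand of `qseq3`. -/
def certificate (x y : ℚ) : ℚ :=
  (9 * x ^ 2 + 30 * x ^ 3 - 41 * x ^ 4 - 119 * x ^ 5 - 48 * x ^ 6 + x ^ 7 - 8 * x ^ 8) +
  (-3 * x - 12 * x ^ 2 + 87 * x ^ 3 + 280 * x ^ 4 + 178 * x ^ 5 + 42 * x ^ 6 + 48 * x ^ 7) * y +
  (10 * x - 29 * x ^ 2 - 261 * x ^ 3 - 314 * x ^ 4 - 161 * x ^ 5 - 120 * x ^ 6) * y ^ 2 +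
  (-13 * x + 68 * x ^ 2 + 234 * x ^ 3 + 220 * x ^ 4 + 160 * x ^ 5) * y ^ 3 +
  (9 * x - 54 * x ^ 2 - 129 * x ^ 3 - 120 * x ^ 4) * y ^ 4 +
  (-4 * x + 26 * x ^ 2 + 48 * x ^ 3) * y ^ 5 +
  (x - 8 * x ^ 2) * y ^ 6

/-- The derivative of `certificate x` at `y`. -/
def certificateDeriv (x y : ℚ) : ℚ :=
  (-3 * x - 12 * x ^ 2 + 87 * x ^ 3 + 280 * x ^ 4 + 178 * x ^ 5 + 42 * x ^ 6 + 48 * x ^ 7) +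
  2 * (10 * x - 29 * x ^ 2 - 261 * x ^ 3 - 314 * x ^ 4 - 161 * x ^ 5 - 120 * x ^ 6) * y +
  3 * (-13 * x + 68 * x ^ 2 + 234 * x ^ 3 + 220 * x ^ 4 + 160 * x ^ 5) * y ^ 2 +
  4 * (9 * x - 54 * x ^ 2 - 129 * x ^ 3 - 120 * x ^ 4) * y ^ 3 +
  5 * (-4 * x + 26 * x ^ 2 + 48 * x ^ 3) * y ^ 4 +
  6 * (x - 8 * x ^ 2) * y ^ 5

/-- The operator annihilating `qseq3`, at index `m + 2`. -/
def recOperator (m : ℕ) (f : ℕ → ℚ) : ℚ :=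
  ((m + 2 : ℚ) + 1) * (8 * (m + 2 : ℚ) - 9) * f (m + 3) -
    (24 * (m + 2 : ℚ) ^ 3 + 13 * (m + 2 : ℚ) ^ 2 - 32 * (m + 2 : ℚ) - 18) * f (m + 2) +
    (m + 2 : ℚ) * (24 * (m + 2 : ℚ) ^ 3 - 75 * (m + 2 : ℚ) ^ 2 + 52 * (m + 2 : ℚ) - 5) * f (m + 1) -
    (m + 2 : ℚ) * ((m + 2 : ℚ) - 1) ^ 3 * (8 * (m + 2 : ℚ) - 1) * f m

lemma rec3_of_recOperator_eq_zero {f : ℕ → ℚ} (h : ∀ m, recOperator m f = 0) : Rec3 f := by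
  intro n hn
  obtain ⟨m, rfl⟩ := Nat.exists_eq_add_of_le' hn
  have := h m
  simp only [recOperator] at this
  rw [show m + 2 - 1 = m + 1 by lia, show m + 2 - 2 = m by lia, show m + 2 + 1 = m + 3 by lia]
  push_cast
  linarith

/-- Creative telescoping for `recOperator`. -/
lemma recOperator_sum_eq_zero (w : ℕ → ℕ → ℚ) (hw : ∀ n k, n < k → w n k = 0) (m : ℕ)
    (c : ℚ) (hc : c ≠ 0) (g : ℕ → ℚ) (g_zero : g 0 = 0) (g_end : g (m + 4) = 0)
    (hg : ∀ k ≤ m + 3, c * recOperator m (fun n => w n k) = g (k + 1) - g k) :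
    recOperator m (fun n => ∑ k ∈ Finset.range (n + 1), w n k) = 0 := by
  have extend : ∀ n ≤ m + 3,
      ∑ k ∈ Finset.range (n + 1), w n k = ∑ k ∈ Finset.range (m + 4), w n k := by
    intro n hn
    refine Finset.sum_subset (Finset.range_mono (by lia)) fun k _ hk => hw n k ?_
    simpa using hk
  have key : c * recOperator m (fun n => ∑ k ∈ Finset.range (m + 4), w n k) = 0 := by
    calc c * recOperator m (fun n => ∑ k ∈ Finset.range (m + 4), w n k)
        = ∑ k ∈ Finset.range (m + 4), c * recOperator m (fun n => w n k) := by
          simp only [recOperator, ← Finset.mul_sum, Finset.sum_add_distrib, Finset.sum_sub_distrib]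
      _ = ∑ k ∈ Finset.range (m + 4), (g (k + 1) - g k) :=
          Finset.sum_congr rfl fun k hk => hg k (by simp at hk; lia)
      _ = 0 := by rw [Finset.sum_range_sub, g_zero, g_end, sub_zero]
  have h := (mul_eq_zero.mp key).resolve_left hc
  simp only [recOperator] at h ⊢
  rw [extend _ le_rfl, extend (m + 2) (by lia), extend (m + 1) (by lia), extend m (by lia)]
  exact h

lemma cast_succ_mul_choose (n k : ℕ) :
    ((n : ℚ) + 1) * n.choose k = (n + 1 - k) * (n + 1).choose k := by
  rcases le_or_gt k (n + 1) with h | h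
  · have := Nat.choose_mul_succ_eq n k
    have h' : ((n.choose k * (n + 1) : ℕ) : ℚ) = ((n + 1).choose k * (n + 1 - k) : ℕ) := by
      rw [this]
    rw [Nat.cast_mul, Nat.cast_mul, Nat.cast_sub h] at h'
    push_cast at h'
    linarith
  · simp [Nat.choose_eq_zero_of_lt h, Nat.choose_eq_zero_of_lt (show n < k by lia)]

lemma chooseCubeFactorial_of_lt {n k : ℕ} (h : n < k) : chooseCubeFactorial n k = 0 := by
  simp [chooseCubeFactorial, Nat.choose_eq_zero_of_lt h]

lemma succ_cube_mul_chooseCubeFactorial (n k : ℕ) :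
    ((n : ℚ) + 1) ^ 3 * chooseCubeFactorial n k =
      (n + 1 - k) ^ 3 * chooseCubeFactorial (n + 1) k := by
  simp only [chooseCubeFactorial, ← mul_assoc, ← mul_pow, cast_succ_mul_choose]

lemma chooseCubeFactorial_succ_right {n k : ℕ} (h : k ≤ n) :
    ((k : ℚ) + 1) ^ 2 * chooseCubeFactorial n (k + 1) =
      (n - k) ^ 3 * chooseCubeFactorial n k := by
  have h' : (n.choose (k + 1) : ℚ) * (k + 1) = n.choose k * (n - k) := by
    rw [← Nat.cast_sub h]
    exact_mod_cast Nat.choose_succ_right_eq n k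
  simp only [chooseCubeFactorial, Nat.factorial_succ, Nat.cast_mul, Nat.cast_succ]
  linear_combination (k.factorial : ℚ) * congrArg (· ^ 3) h'

lemma harmonicWeight_succ_left {n k : ℕ} (h : k ≤ n) :
    ((n : ℚ) + 1 - k) * harmonicWeight n k = (n + 1 - k) * harmonicWeight (n + 1) k - 3 := by
  have h0 : ((n - k : ℕ) : ℚ) + 1 ≠ 0 := by positivity
  rw [Nat.cast_sub h] at h0
  rw [harmonicWeight, harmonicWeight, Nat.succ_sub h, harmonic_succ]
  push_cast [Nat.cast_sub h]
  field_simp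
  ring

lemma harmonicWeight_succ_right {n k : ℕ} (h : k < n) :
    ((n : ℚ) - k) * (k + 1) * harmonicWeight n (k + 1) =
      (n - k) * (k + 1) * harmonicWeight n k - 3 * (k + 1) - 2 * (n - k) := by
  obtain ⟨d, rfl⟩ := Nat.exists_eq_add_of_lt h
  rw [harmonicWeight, harmonicWeight, show k + d + 1 - k = d + 1 by lia,
    show k + d + 1 - (k + 1) = d by lia, harmonic_succ, harmonic_succ]
  push_cast
  field_simp
  ring

/-- The weighted analogue of `succ_cube_mul_chooseCubeFactorial`. -/
lemma succ_cube_mul_chooseCubeFactorial_mul_harmonicWeight (n k : ℕ) :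
    ((n : ℚ) + 1) ^ 3 * (chooseCubeFactorial n k * harmonicWeight n k) =
      (n + 1 - k) ^ 3 * (chooseCubeFactorial (n + 1) k * harmonicWeight (n + 1) k) -
        3 * (n + 1 - k) ^ 2 * chooseCubeFactorial (n + 1) k := by
  rcases le_or_gt k n with h | h
  · linear_combination harmonicWeight n k * succ_cube_mul_chooseCubeFactorial n k +
      (n + 1 - k : ℚ) ^ 2 * chooseCubeFactorial (n + 1) k * harmonicWeight_succ_left h
  · rw [chooseCubeFactorial_of_lt h]
    rcases Nat.lt_or_ge (n + 1) k with h' | h'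
    · simp [chooseCubeFactorial_of_lt h']
    · obtain rfl : k = n + 1 := by lia
      simp

/-- The weighted analogue of `chooseCubeFactorial_succ_right`. -/
lemma chooseCubeFactorial_mul_harmonicWeight_succ_right {n k : ℕ} (h : k ≤ n) :
    ((k : ℚ) + 1) ^ 2 * (chooseCubeFactorial n (k + 1) * harmonicWeight n (k + 1)) +
        2 * (k + 1) * chooseCubeFactorial n (k + 1) =
      (n - k) ^ 3 * (chooseCubeFactorial n k * harmonicWeight n k) -
        3 * (n - k) ^ 2 * chooseCubeFactorial n k := by
  rcases h.eq_or_lt with rfl | h'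
  · simp [chooseCubeFactorial_of_lt (Nat.lt_succ_self k)]
  · have hk : (k : ℚ) + 1 ≠ 0 := by positivity
    refine mul_left_cancel₀ hk ?_
    linear_combination
      ((k + 1) * harmonicWeight n (k + 1) + 2) * chooseCubeFactorial_succ_right h +
        (n - k : ℚ) ^ 2 * chooseCubeFactorial n k * harmonicWeight_succ_right h'

lemma recOperator_chooseCubeFactorial {m k : ℕ} (hk : k ≤ m + 3) :
    ((m + 3 : ℚ) ^ 3 * (m + 2) ^ 3) * recOperator m (fun n => chooseCubeFactorial n k) =
      ((k + 1 : ℕ) : ℚ) ^ 2 * certificate (m + 2) (k + 1 : ℕ) *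
          chooseCubeFactorial (m + 3) (k + 1) -
        (k : ℚ) ^ 2 * certificate (m + 2) k * chooseCubeFactorial (m + 3) k := by
  have e0 := succ_cube_mul_chooseCubeFactorial m k
  have e1 := succ_cube_mul_chooseCubeFactorial (m + 1) k
  have e2 := succ_cube_mul_chooseCubeFactorial (m + 2) k
  have e3 := chooseCubeFactorial_succ_right hk
  obtain ⟨x, hx⟩ : ∃ x : ℚ, x = m + 2 := ⟨_, rfl⟩
  have hm : (m : ℚ) = x - 2 := by linarith
  simp only [recOperator]
  push_cast at e0 e1 e2 e3 ⊢
  rw [hm] at e0 e1 e2 e3 ⊢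
  rw [show x - 2 + 2 = x by ring]
  linear_combination (norm := (simp only [certificate]; ring))
    (-(x * (8 * x - 1)) * (x + 1) ^ 3 * x ^ 3) * e0 +
    ((x + 1) ^ 3 * (x * (24 * x ^ 3 - 75 * x ^ 2 + 52 * x - 5) -
      x * (8 * x - 1) * (x - 1 - k) ^ 3)) * e1 +
    (-(24 * x ^ 3 + 13 * x ^ 2 - 32 * x - 18) * x ^ 3 + (x - k) ^ 3 * (x * (24 * x ^ 3 - 75 * x ^ 2 + 52 * x - 5) -
      x * (8 * x - 1) * (x - 1 - k) ^ 3)) * e2 -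
    certificate x (k + 1) * e3

lemma recOperator_chooseCubeFactorial_mul_harmonicWeight {m k : ℕ} (hk : k ≤ m + 3) :
    ((m + 3 : ℚ) ^ 3 * (m + 2) ^ 3) *
        recOperator m (fun n => chooseCubeFactorial n k * harmonicWeight n k) =
      (((k + 1 : ℕ) : ℚ) ^ 2 * certificate (m + 2) (k + 1 : ℕ) *
          (chooseCubeFactorial (m + 3) (k + 1) * harmonicWeight (m + 3) (k + 1)) +
        (2 * (k + 1 : ℕ) * certificate (m + 2) (k + 1 : ℕ) +
            ((k + 1 : ℕ) : ℚ) ^ 2 * certificateDeriv (m + 2) (k + 1 : ℕ)) *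
          chooseCubeFactorial (m + 3) (k + 1)) -
      ((k : ℚ) ^ 2 * certificate (m + 2) k *
          (chooseCubeFactorial (m + 3) k * harmonicWeight (m + 3) k) +
        (2 * k * certificate (m + 2) k + (k : ℚ) ^ 2 * certificateDeriv (m + 2) k) *
          chooseCubeFactorial (m + 3) k) := by
  have e1 := succ_cube_mul_chooseCubeFactorial (m + 1) k
  have e2 := succ_cube_mul_chooseCubeFactorial (m + 2) k
  have e3 := chooseCubeFactorial_succ_right hk
  have w0 := succ_cube_mul_chooseCubeFactorial_mul_harmonicWeight m k
  have w1 := succ_cube_mul_chooseCubeFactorial_mul_harmonicWeight (m + 1) k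
  have w2 := succ_cube_mul_chooseCubeFactorial_mul_harmonicWeight (m + 2) k
  have w3 := chooseCubeFactorial_mul_harmonicWeight_succ_right hk
  obtain ⟨x, hx⟩ : ∃ x : ℚ, x = m + 2 := ⟨_, rfl⟩
  have hm : (m : ℚ) = x - 2 := by linarith
  simp only [recOperator]
  push_cast at e1 e2 e3 w0 w1 w2 w3 ⊢
  rw [hm] at e1 e2 e3 w0 w1 w2 w3 ⊢
  rw [show x - 2 + 2 = x by ring]
  linear_combination (norm := (simp only [certificate, certificateDeriv]; ring))
    (-(x * (8 * x - 1)) * (x + 1) ^ 3 * x ^ 3) * w0 +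
    ((x + 1) ^ 3 * (x * (24 * x ^ 3 - 75 * x ^ 2 + 52 * x - 5) -
      x * (8 * x - 1) * (x - 1 - k) ^ 3)) * w1 +
    (-(24 * x ^ 3 + 13 * x ^ 2 - 32 * x - 18) * x ^ 3 + (x - k) ^ 3 * (x * (24 * x ^ 3 - 75 * x ^ 2 + 52 * x - 5) -
      x * (8 * x - 1) * (x - 1 - k) ^ 3)) * w2 -
    certificate x (k + 1) * w3 +
    (3 * (x * (8 * x - 1)) * (x + 1) ^ 3 * (x - 1 - k) ^ 2) * e1 +
    (3 * (x * (8 * x - 1)) * (x - 1 - k) ^ 2 * (x - k) ^ 3 - 3 * (x - k) ^ 2 * (x * (24 * x ^ 3 - 75 * x ^ 2 + 52 * x - 5) -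
      x * (8 * x - 1) * (x - 1 - k) ^ 3)) * e2 -
    certificateDeriv x (k + 1) * e3

theorem stmt_10 : Rec3 qseq3 ∧ Rec3 pseq31 := by
  have hc : ∀ m : ℕ, ((m + 3 : ℚ) ^ 3 * (m + 2) ^ 3) ≠ 0 := fun m => by positivity
  refine ⟨rec3_of_recOperator_eq_zero fun m => ?_, rec3_of_recOperator_eq_zero fun m => ?_⟩
  · exact recOperator_sum_eq_zero chooseCubeFactorial (fun _ _ => chooseCubeFactorial_of_lt)
      m _ (hc m)
      (fun k => (k : ℚ) ^ 2 * certificate (m + 2) k * chooseCubeFactorial (m + 3) k)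
      (by simp) (by simp [chooseCubeFactorial_of_lt (Nat.lt_succ_self (m + 3))])
      (fun k hk => recOperator_chooseCubeFactorial hk)
  · exact recOperator_sum_eq_zero (fun n k => chooseCubeFactorial n k * harmonicWeight n k)
      (fun _ _ h => by simp [chooseCubeFactorial_of_lt h]) m _ (hc m)
      (fun k => (k : ℚ) ^ 2 * certificate (m + 2) k *
          (chooseCubeFactorial (m + 3) k * harmonicWeight (m + 3) k) +
        (2 * k * certificate (m + 2) k + (k : ℚ) ^ 2 * certificateDeriv (m + 2) k) *
          chooseCubeFactorial (m + 3) k)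
      (by simp) (by simp [chooseCubeFactorial_of_lt (Nat.lt_succ_self (m + 3))])
      (fun k hk => recOperator_chooseCubeFactorial_mul_harmonicWeight hk)
end

section
/- Let p_{n,2} = ∑_{k=0}^n C(n,k)³·k!·((3H_{n−k} − 2H_k)² + 3H_{n−k}^{(2)} + 2H_k^{(2)}). Then for every integer n ≥ 2: (n+1)(8n−9)·p_{n+1,2} = (24n³+13n²−32n−18)·p_{n,2} − n(24n³−75n²+52n−5)·p_{n−1,2} + n(n−1)³(8n−1)·p_{n−2,2} + 2(8n⁴−17n³+74n²−12n−9)/(n(n+1)). -/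
/-- Generalized harmonic number `H_n^{(2)} = ∑_{j=1}^n 1/j²`. -/
noncomputable def genHarmonic2 (n : ℕ) : ℚ :=
  ∑ j ∈ Finset.range n, (1 : ℚ) / ((j : ℚ) + 1) ^ 2

/-- `p_{n,2} = ∑_{k=0}^n C(n,k)³ · k! · ((3H_{n-k} - 2H_k)² + 3H_{n-k}^{(2)} + 2H_k^{(2)})`. -/
noncomputable def pseq32 (n : ℕ) : ℚ :=
  ∑ k ∈ Finset.range (n + 1), (n.choose k : ℚ) ^ 3 * (Nat.factorial k : ℚ) *
    ((3 * harmonic (n - k) - 2 * harmonic k) ^ 2 +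
      3 * genHarmonic2 (n - k) + 2 * genHarmonic2 k)

open Polynomial in
/-- Second derivative in `x` at `x = k` of `f x * n! ^ 3 / (Γ(x + 1) ^ 2 * Γ(n - x + 1) ^ 3)`, up to
a normalization independent of `n`, `k` and `f`. -/
noncomputable def summandJet (n k : ℕ) : ℚ[X] →ₗ[ℚ] ℚ where
  toFun f := (n.choose k : ℚ) ^ 3 * (Nat.factorial k : ℚ) *
    ((derivative (derivative f)).eval (k : ℚ) +
      2 * (derivative f).eval (k : ℚ) * (3 * harmonic (n - k) - 2 * harmonic k) +
      f.eval (k : ℚ) * ((3 * harmonic (n - k) - 2 * harmonic k) ^ 2 +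
        3 * genHarmonic2 (n - k) + 2 * genHarmonic2 k))
  map_add' f g := by
    simp only [derivative_add, eval_add]
    ring
  map_smul' c f := by
    simp only [derivative_smul, eval_smul, smul_eq_mul, RingHom.id_apply]
    ring

open Polynomial in
theorem summandJet_apply (n k : ℕ) (f : ℚ[X]) :
    summandJet n k f = (n.choose k : ℚ) ^ 3 * (Nat.factorial k : ℚ) *
      ((derivative (derivative f)).eval (k : ℚ) +
        2 * (derivative f).eval (k : ℚ) * (3 * harmonic (n - k) - 2 * harmonic k) +
        f.eval (k : ℚ) * ((3 * harmonic (n - k) - 2 * harmonic k) ^ 2 +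
          3 * genHarmonic2 (n - k) + 2 * genHarmonic2 k)) := rfl

theorem summandJet_of_lt {n k : ℕ} (h : n < k) (f : Polynomial ℚ) : summandJet n k f = 0 := by
  simp [summandJet_apply, Nat.choose_eq_zero_of_lt h]

theorem genHarmonic2_succ (n : ℕ) :
    genHarmonic2 (n + 1) = genHarmonic2 n + 1 / ((n : ℚ) + 1) ^ 2 :=
  Finset.sum_range_succ _ _

open Polynomial in
theorem summandJet_cube_sub_X_mul (n k : ℕ) (f : ℚ[X]) :
    summandJet (n + 1) k ((C ((n : ℚ) + 1) - X) ^ 3 * f) =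
      ((n : ℚ) + 1) ^ 3 * summandJet n k f := by
  rcases lt_trichotomy k (n + 1) with h | rfl | h
  · obtain ⟨m, rfl⟩ := Nat.exists_eq_add_of_le (Nat.lt_succ_iff.mp h)
    have hc : ((k + m + 1).choose k : ℚ) * (m + 1) = (k + m + 1) * ((k + m).choose k : ℚ) := by
      have := Nat.choose_mul_succ_eq (k + m) k
      rw [show k + m + 1 - k = m + 1 by lia] at this
      exact_mod_cast (this.symm.trans (mul_comm _ _))
    have hm : (m : ℚ) + 1 ≠ 0 := by positivity
    rw [← eq_div_iff hm] at hc
    simp only [summandJet_apply, show k + m + 1 - k = m + 1 by lia, Nat.add_sub_cancel_left,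
      harmonic_succ, genHarmonic2_succ, hc]
    simp [derivative_pow]
    field_simp
    ring
  · simp [summandJet_apply, derivative_pow]
  · simp [summandJet_of_lt h, summandJet_of_lt (n.lt_succ_self.trans h)]

open Polynomial in
theorem summandJet_succ_X_sq_mul (n k : ℕ) (f : ℚ[X]) :
    summandJet n (k + 1) (X ^ 2 * f) =
      summandJet n k ((C (n : ℚ) - X) ^ 3 * f.comp (X + 1)) := by
  rcases lt_trichotomy k n with h | rfl | h
  · obtain ⟨m, rfl⟩ := Nat.exists_eq_add_of_lt h
    have hc : ((k + m + 1).choose (k + 1) : ℚ) * (k + 1) = ((k + m + 1).choose k : ℚ) * (m + 1) := by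
      have := Nat.choose_succ_right_eq (k + m + 1) k
      rw [show k + m + 1 - k = m + 1 by lia] at this
      exact_mod_cast this
    have hk : (k : ℚ) + 1 ≠ 0 := by positivity
    have hm : (m : ℚ) + 1 ≠ 0 := by positivity
    rw [← eq_div_iff hk] at hc
    simp only [summandJet_apply, show k + m + 1 - k = m + 1 by lia,
      show k + m + 1 - (k + 1) = m by lia, harmonic_succ, genHarmonic2_succ, hc,
      Nat.factorial_succ]
    simp [derivative_pow, derivative_comp]
    field_simp
    ring
  · simp [summandJet_apply, derivative_pow]
  · simp [summandJet_of_lt h, summandJet_of_lt (h.trans k.lt_succ_self)]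

theorem pseq32_eq_sum_summandJet {n m : ℕ} (h : n < m) :
    pseq32 n = ∑ k ∈ Finset.range m, summandJet n k 1 := by
  rw [← Finset.sum_subset (Finset.range_mono h)]
  · simp [pseq32, summandJet_apply]
  · intro k _ hk
    exact summandJet_of_lt (by simpa using hk) 1

open Polynomial in
/-- The polynomial factor of the creative telescoping certificate. -/
noncomputable def telescopingPoly (a : ℚ) : ℚ[X] :=
  C (9 * a + 30 * a ^ 2 - 41 * a ^ 3 - 119 * a ^ 4 - 48 * a ^ 5 + a ^ 6 - 8 * a ^ 7) +
  C (-3 - 12 * a + 87 * a ^ 2 + 280 * a ^ 3 + 178 * a ^ 4 + 42 * a ^ 5 + 48 * a ^ 6) * X +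
  C (10 - 29 * a - 261 * a ^ 2 - 314 * a ^ 3 - 161 * a ^ 4 - 120 * a ^ 5) * X ^ 2 +
  C (-13 + 68 * a + 234 * a ^ 2 + 220 * a ^ 3 + 160 * a ^ 4) * X ^ 3 +
  C (9 - 54 * a - 129 * a ^ 2 - 120 * a ^ 3) * X ^ 4 +
  C (-4 + 26 * a + 48 * a ^ 2) * X ^ 5 +
  C (1 - 8 * a) * X ^ 6

open Polynomial in
theorem telescopingPoly_spec (a : ℚ) :
    (C (a + 1) - X) ^ 3 * (telescopingPoly a).comp (X + 1) - X ^ 2 * telescopingPoly a =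
      ((a + 1) ^ 4 * a ^ 2 * (8 * a - 9)) • (1 : ℚ[X]) -
      (a ^ 2 * (24 * a ^ 3 + 13 * a ^ 2 - 32 * a - 18)) • (C (a + 1) - X) ^ 3 +
      (24 * a ^ 3 - 75 * a ^ 2 + 52 * a - 5) • ((C (a + 1) - X) ^ 3 * (C a - X) ^ 3) -
      (8 * a - 1) • ((C (a + 1) - X) ^ 3 * ((C a - X) ^ 3 * (C (a - 1) - X) ^ 3)) := by
  refine Polynomial.funext fun x => ?_
  simp [telescopingPoly]
  ring

open Polynomial in
theorem summandJet_telescope (m k : ℕ) (a : ℚ) (ha : a = m + 2) :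
    summandJet (m + 3) (k + 1) (X ^ 2 * telescopingPoly a) -
        summandJet (m + 3) k (X ^ 2 * telescopingPoly a) =
      (a + 1) ^ 3 * a ^ 2 * ((a + 1) * (8 * a - 9) * summandJet (m + 3) k 1 -
        (24 * a ^ 3 + 13 * a ^ 2 - 32 * a - 18) * summandJet (m + 2) k 1 +
        a * (24 * a ^ 3 - 75 * a ^ 2 + 52 * a - 5) * summandJet (m + 1) k 1 -
        a * (a - 1) ^ 3 * (8 * a - 1) * summandJet m k 1) := by
  have h0 (f : ℚ[X]) : summandJet (m + 3) k ((C (a + 1) - X) ^ 3 * f) =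
      (a + 1) ^ 3 * summandJet (m + 2) k f := by
    have := summandJet_cube_sub_X_mul (m + 2) k f
    push_cast at this
    rwa [← ha] at this
  have h1 (f : ℚ[X]) : summandJet (m + 2) k ((C a - X) ^ 3 * f) =
      a ^ 3 * summandJet (m + 1) k f := by
    have := summandJet_cube_sub_X_mul (m + 1) k f
    push_cast at this
    rwa [show (m : ℚ) + 1 + 1 = a by linarith] at this
  have h2 (f : ℚ[X]) : summandJet (m + 1) k ((C (a - 1) - X) ^ 3 * f) =
      (a - 1) ^ 3 * summandJet m k f := by
    have := summandJet_cube_sub_X_mul m k f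
    rwa [show (m : ℚ) + 1 = a - 1 by linarith] at this
  have hs : ((m + 3 : ℕ) : ℚ) = a + 1 := by
    push_cast
    linarith
  rw [summandJet_succ_X_sq_mul, hs, ← map_sub, telescopingPoly_spec]
  have h0' := h0 1
  have h1' := h1 1
  have h2' := h2 1
  rw [mul_one] at h0' h1' h2'
  simp only [LinearMap.map_add, LinearMap.map_sub, LinearMap.map_smul, smul_eq_mul]
  rw [h0', h0, h0, h1, h1', h2']
  ring

theorem stmt_11 :
    ∀ n : ℕ, 2 ≤ n →
      ((n : ℚ) + 1) * (8 * (n : ℚ) - 9) * pseq32 (n + 1) =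
        (24 * (n : ℚ) ^ 3 + 13 * (n : ℚ) ^ 2 - 32 * (n : ℚ) - 18) * pseq32 n -
          (n : ℚ) * (24 * (n : ℚ) ^ 3 - 75 * (n : ℚ) ^ 2 + 52 * (n : ℚ) - 5) * pseq32 (n - 1) +
          (n : ℚ) * ((n : ℚ) - 1) ^ 3 * (8 * (n : ℚ) - 1) * pseq32 (n - 2) +
          2 * (8 * (n : ℚ) ^ 4 - 17 * (n : ℚ) ^ 3 + 74 * (n : ℚ) ^ 2 - 12 * (n : ℚ) - 9) /
            ((n : ℚ) * ((n : ℚ) + 1)) := by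
  intro n hn
  obtain ⟨m, rfl⟩ := Nat.exists_eq_add_of_le' hn
  obtain ⟨a, ha⟩ : ∃ a : ℚ, a = m + 2 := ⟨_, rfl⟩
  have ha' : ((m + 2 : ℕ) : ℚ) = a := by
    push_cast
    exact ha.symm
  have hpos : 0 < a := by
    rw [ha]
    positivity
  simp only [ha', show m + 2 + 1 = m + 3 by lia, show m + 2 - 1 = m + 1 by lia,
    Nat.add_sub_cancel]
  have hsum := Finset.sum_congr (rfl : Finset.range (m + 4) = Finset.range (m + 4))
    fun k _ => summandJet_telescope m k a ha
  rw [Finset.sum_range_sub (fun k => summandJet (m + 3) k (Polynomial.X ^ 2 * telescopingPoly a)),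
    summandJet_of_lt (by lia)] at hsum
  simp only [← Finset.mul_sum, Finset.sum_sub_distrib, Finset.sum_add_distrib] at hsum
  rw [← pseq32_eq_sum_summandJet (by lia), ← pseq32_eq_sum_summandJet (by lia),
    ← pseq32_eq_sum_summandJet (by lia), ← pseq32_eq_sum_summandJet (by lia)] at hsum
  have hbdry : summandJet (m + 3) 0 (Polynomial.X ^ 2 * telescopingPoly a) =
      2 * (9 * a + 30 * a ^ 2 - 41 * a ^ 3 - 119 * a ^ 4 - 48 * a ^ 5 + a ^ 6 - 8 * a ^ 7) := by
    simp [summandJet_apply, telescopingPoly, Polynomial.derivative_pow]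
  rw [hbdry] at hsum
  have hne : (a + 1) ^ 3 * a ^ 2 ≠ 0 := by positivity
  refine mul_left_cancel₀ hne ?_
  have hfrac : (a + 1) ^ 3 * a ^ 2 *
      (2 * (8 * a ^ 4 - 17 * a ^ 3 + 74 * a ^ 2 - 12 * a - 9) / (a * (a + 1))) =
      2 * (a + 1) ^ 2 * a * (8 * a ^ 4 - 17 * a ^ 3 + 74 * a ^ 2 - 12 * a - 9) := by
    field_simp
  linear_combination -hsum - hfrac
end

section
/- Let m ≥ 2 be an even integer. Then ∑_{k=0}^m C(m,k)·2^k·B_k^{(m+1)}((m+1)/2) = 0, where B_k^{(m+1)}((m+1)/2) = ∑_{k_0+⋯+k_m=k} (k!/(k_0!⋯k_m!))·∏_{i=0}^m B_{k_i}(1/2), the sum being over all (m+1)-tuples of nonnegative integers with k_0+⋯+k_m = k. -/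
/-- The generalized (order-`m`) Bernoulli polynomial of degree `N` evaluated at `m/2`,
written as the `m`-fold convolution of Bernoulli polynomial values at `1/2`:
`B_N^{(m)}(m/2) = ∑_{k_1+⋯+k_m=N} (N!/(k_1!⋯k_m!)) · ∏_i B_{k_i}(1/2)`. -/
noncomputable def genBernoulliHalf (m N : ℕ) : ℚ :=
  ∑ k ∈ Finset.Nat.antidiagonalTuple m N,
    ((Nat.factorial N : ℚ) / ∏ i, (Nat.factorial (k i) : ℚ)) *
      ∏ i, (Polynomial.bernoulli (k i)).eval (1 / 2 : ℚ)

open PowerSeries in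
/-- The power series `t / sinh t`, in the form `∑ 2 ^ n * B_n(1 / 2) * t ^ n / n!`. -/
noncomputable def divSinhSeries : PowerSeries ℚ :=
  rescale 2 (mk fun n => (Polynomial.bernoulli n).eval (1 / 2 : ℚ) / (n.factorial : ℚ))

open PowerSeries in
theorem divSinhSeries_mul_exp_sq_sub_one :
    divSinhSeries * (exp ℚ ^ 2 - 1) = 2 * X * exp ℚ := by
  have h := congrArg (rescale (2 : ℚ)) (Polynomial.bernoulli_generating_function (1 / 2 : ℚ))
  have hE : rescale (2 : ℚ) (exp ℚ) = exp ℚ ^ 2 := by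
    simpa using (exp_pow_eq_rescale_exp (A := ℚ) 2).symm
  have hG : (mk fun n => Polynomial.aeval (1 / 2 : ℚ)
      ((1 / (n.factorial : ℚ)) • Polynomial.bernoulli n)) =
      mk fun n => (Polynomial.bernoulli n).eval (1 / 2 : ℚ) / (n.factorial : ℚ) := by
    ext n
    simp [div_eq_inv_mul]
  rw [hG, map_mul, map_mul, map_sub, map_one, hE, rescale_rescale, rescale_X] at h
  rw [show (C 2 : PowerSeries ℚ) = 2 from rfl] at h
  simpa [divSinhSeries] using h

open PowerSeries in
theorem evalNegHom_divSinhSeries : evalNegHom divSinhSeries = divSinhSeries := by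
  ext n
  have h := Polynomial.bernoulli_eval_one_sub n (1 / 2)
  rw [show (1 - 1 / 2 : ℚ) = 1 / 2 by norm_num] at h
  simp only [evalNegHom, divSinhSeries, coeff_rescale, coeff_mk]
  conv_rhs => rw [h]
  ring

open PowerSeries in
theorem coeff_divSinhSeries_pow_of_odd (m : ℕ) {n : ℕ} (hn : Odd n) :
    coeff n (divSinhSeries ^ m) = 0 := by
  have h : evalNegHom (divSinhSeries ^ m) = divSinhSeries ^ m := by
    rw [map_pow, evalNegHom_divSinhSeries]
  have hc := congrArg (coeff n) h
  rw [evalNegHom, coeff_rescale, hn.neg_one_pow] at hc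
  linarith

open PowerSeries in
theorem exp_mul_divSinhSeries_sq :
    exp ℚ * divSinhSeries ^ 2 =
      divSinhSeries + X * divSinhSeries - X * derivative ℚ divSinhSeries := by
  have h := divSinhSeries_mul_exp_sq_sub_one
  have hd := congrArg (derivative ℚ) h
  rw [show (2 : PowerSeries ℚ) = C 2 from rfl] at hd
  simp only [Derivation.leibniz, map_sub, derivative_pow, derivative_exp, derivative_X,
    derivative_C, derivative_one, smul_eq_mul] at hd
  rw [show C 2 = (2 : PowerSeries ℚ) from rfl] at hd
  have hE : (2 * exp ℚ : PowerSeries ℚ) ≠ 0 :=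
    mul_ne_zero (by
      rw [show (2 : PowerSeries ℚ) = C 2 from rfl, Ne, map_eq_zero_iff C C_injective]
      norm_num) (isUnit_exp ℚ).ne_zero
  apply mul_left_cancel₀ hE
  push_cast at hd
  linear_combination divSinhSeries * hd - derivative ℚ divSinhSeries * h

open PowerSeries in
theorem coeff_exp_mul_divSinhSeries_pow (m : ℕ) (hm : m ≠ 0) (hme : Even m) :
    coeff m (exp ℚ * divSinhSeries ^ (m + 1)) = 0 := by
  obtain ⟨n, rfl⟩ := Nat.exists_eq_succ_of_ne_zero hm
  have hn : Odd n := by grind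
  have key : C (n + 1 : ℚ) * (exp ℚ * divSinhSeries ^ (n + 1 + 1)) =
      C (n + 1 : ℚ) * divSinhSeries ^ (n + 1) + C (n + 1 : ℚ) * (X * divSinhSeries ^ (n + 1)) -
        X * derivative ℚ (divSinhSeries ^ (n + 1)) := by
    rw [derivative_pow]
    simp only [map_add, map_natCast, map_one, Nat.cast_add, Nat.cast_one, Nat.add_sub_cancel]
    linear_combination ((n : PowerSeries ℚ) + 1) * divSinhSeries ^ n * exp_mul_divSinhSeries_sq
  have hc := congrArg (coeff (n + 1)) key
  rw [map_sub (coeff (n + 1)), map_add (coeff (n + 1))] at hc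
  simp only [coeff_C_mul, coeff_succ_X_mul, coeff_derivative,
    coeff_divSinhSeries_pow_of_odd (n + 1) hn] at hc
  have hn0 : (n + 1 : ℚ) ≠ 0 := by positivity
  apply mul_left_cancel₀ hn0
  simp only [Nat.succ_eq_add_one]
  linarith

open PowerSeries in
theorem coeff_divSinhSeries_pow (m N : ℕ) :
    coeff N (divSinhSeries ^ m) = 2 ^ N * genBernoulliHalf m N / (N.factorial : ℚ) := by
  have hprod (f : PowerSeries ℚ) : coeff N (f ^ m) =
      ∑ k ∈ Finset.Nat.antidiagonalTuple m N, ∏ i, coeff (k i) f := by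
    have h := coeff_prod (fun _ : Fin m => f) N Finset.univ
    rw [Finset.prod_const, Finset.card_univ, Fintype.card_fin] at h
    rw [h]
    refine Finset.sum_bij' (fun l _ => ⇑l) (fun k _ => Finsupp.equivFunOnFinite.symm k)
      ?_ ?_ ?_ ?_ ?_ <;> simp [Finset.Nat.mem_antidiagonalTuple, Finset.mem_finsuppAntidiag]
  have hN : (N.factorial : ℚ) ≠ 0 := by positivity
  rw [divSinhSeries, ← map_pow, coeff_rescale, hprod, genBernoulliHalf, mul_div_assoc,
    Finset.sum_div]
  congr 1
  refine Finset.sum_congr rfl fun k _ => ?_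
  simp only [coeff_mk, Finset.prod_div_distrib]
  field_simp

theorem stmt_15 (m : ℕ) (hm : 2 ≤ m) (hme : Even m) :
    ∑ k ∈ Finset.range (m + 1),
      (m.choose k : ℚ) * 2 ^ k * genBernoulliHalf (m + 1) k = 0 := by
  have h := coeff_exp_mul_divSinhSeries_pow m (by omega) hme
  rw [mul_comm, PowerSeries.coeff_mul, Finset.Nat.sum_antidiagonal_eq_sum_range_succ_mk] at h
  rw [← mul_zero (m.factorial : ℚ), ← h, Finset.mul_sum]
  refine Finset.sum_congr rfl fun k hk => ?_
  have hkm : k ≤ m := Nat.lt_succ_iff.mp (Finset.mem_range.mp hk)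
  rw [coeff_divSinhSeries_pow, PowerSeries.coeff_exp, Nat.cast_choose ℚ hkm]
  simp only [eq_ratCast, Rat.cast_id]
  field_simp
end

section
/- Let m ≥ 1 be an integer. Then for every rational number x: ∑_{k_0+⋯+k_m=m} (m!/(k_0!⋯k_m!))·∏_{i=0}^m B_{k_i}(x/(m+1)) = (x−1)(x−2)⋯(x−m), the sum being over all (m+1)-tuples of nonnegative integers with k_0+⋯+k_m = m (i.e., B_m^{(m+1)}(x) = (x−1)(x−2)⋯(x−m)). -/
/-- The generalized (order-`m`) Bernoulli polynomial of degree `N` evaluated at `m·x`,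
written as the `m`-fold convolution of Bernoulli polynomial values at `x`:
`B_N^{(m)}(m·x) = ∑_{k_1+⋯+k_m=N} (N!/(k_1!⋯k_m!)) · ∏_i B_{k_i}(x)`. -/
noncomputable def genBernoulliAt (m N : ℕ) (x : ℚ) : ℚ :=
  ∑ k ∈ Finset.Nat.antidiagonalTuple m N,
    ((Nat.factorial N : ℚ) / ∏ i, (Nat.factorial (k i) : ℚ)) *
      ∏ i, (Polynomial.bernoulli (k i)).eval x

open PowerSeries in
/-- The coefficients of a finite product of power series, as a sum over tuples. -/
theorem PowerSeries.coeff_prod_antidiagonalTuple {R : Type*} [CommSemiring R] (k n : ℕ)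
    (f : Fin k → R⟦X⟧) :
    coeff n (∏ i, f i) =
      ∑ l ∈ Finset.Nat.antidiagonalTuple k n, ∏ i, coeff (l i) (f i) := by
  rw [coeff_prod]
  refine Finset.sum_bij' (fun l _ => l) (fun l _ => Finsupp.equivFunOnFinite.symm l) ?_ ?_ ?_ ?_ ?_
  · intro l hl
    simpa [Finset.Nat.mem_antidiagonalTuple, Finset.mem_finsuppAntidiag] using hl
  · intro l hl
    simpa [Finset.Nat.mem_antidiagonalTuple, Finset.mem_finsuppAntidiag] using hl
  · intro l _
    ext; simp
  · intro l _
    ext; simp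
  · intro l _
    rfl

open PowerSeries in
theorem PowerSeries.derivative_rescale_exp (A : Type*) [CommRing A] [Algebra ℚ A] (a : A) :
    d⁄dX A (rescale a (exp A)) = C a * rescale a (exp A) := by
  ext n
  have h := congrArg (coeff n) (derivative_exp A)
  rw [coeff_derivative] at h
  rw [coeff_derivative, coeff_C_mul, coeff_rescale, coeff_rescale, ← h]
  ring

open PowerSeries in
theorem PowerSeries.rescale_exp_pow (A : Type*) [CommRing A] [Algebra ℚ A] (a : A) (n : ℕ) :
    rescale a (exp A) ^ n = rescale (n * a) (exp A) := by
  rw [← map_pow, exp_pow_eq_rescale_exp, rescale_rescale]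

open PowerSeries in
theorem exp_sub_one_ne_zero : exp ℚ - 1 ≠ 0 := by
  intro h
  have := bernoulliPowerSeries_mul_exp_sub_one ℚ
  rw [h, mul_zero] at this
  exact X_ne_zero this.symm

open PowerSeries in
/-- The exponential generating function of the Bernoulli polynomials at `y` factors as
`t / (e^t - 1)` times `e^{yt}`. -/
theorem mk_bernoulli_eval_eq (y : ℚ) :
    (mk fun n => (Polynomial.bernoulli n).eval y / (n.factorial : ℚ)) =
      bernoulliPowerSeries ℚ * rescale y (exp ℚ) := by
  apply mul_right_cancel₀ exp_sub_one_ne_zero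
  rw [mul_right_comm, bernoulliPowerSeries_mul_exp_sub_one,
    ← Polynomial.bernoulli_generating_function]
  congr 2
  ext n
  simp [Polynomial.aeval_def, Polynomial.eval₂_eq_eval_map, div_eq_inv_mul]

open PowerSeries in
/-- The Riccati equation satisfied by `t / (e^t - 1)`. -/
theorem X_mul_derivative_bernoulliPowerSeries :
    X * d⁄dX ℚ (bernoulliPowerSeries ℚ) =
      bernoulliPowerSeries ℚ - X * bernoulliPowerSeries ℚ - bernoulliPowerSeries ℚ ^ 2 := by
  have h := bernoulliPowerSeries_mul_exp_sub_one ℚ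
  have hd := congrArg (d⁄dX ℚ) h
  rw [Derivation.leibniz, map_sub, derivative_exp, derivative_one, derivative_X] at hd
  simp only [smul_eq_mul, sub_zero] at hd
  linear_combination bernoulliPowerSeries ℚ * hd -
    (d⁄dX ℚ (bernoulliPowerSeries ℚ) + bernoulliPowerSeries ℚ) * h

open PowerSeries in
theorem X_mul_derivative_bernoulliPowerSeries_pow_mul (n : ℕ) (x : ℚ) :
    X * d⁄dX ℚ (bernoulliPowerSeries ℚ ^ n * rescale x (exp ℚ)) =
      C (n : ℚ) * (bernoulliPowerSeries ℚ ^ n * rescale x (exp ℚ)) +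
        C (x - n) * (X * (bernoulliPowerSeries ℚ ^ n * rescale x (exp ℚ))) -
        C (n : ℚ) * (bernoulliPowerSeries ℚ ^ (n + 1) * rescale x (exp ℚ)) := by
  rw [Derivation.leibniz, derivative_rescale_exp, derivative_pow]
  simp only [smul_eq_mul, map_sub, map_natCast]
  cases n with
  | zero => simp; ring
  | succ k =>
    rw [Nat.add_sub_cancel]
    linear_combination ((k + 1 : ℕ) : ℚ⟦X⟧) * bernoulliPowerSeries ℚ ^ k * rescale x (exp ℚ) *
      X_mul_derivative_bernoulliPowerSeries

open PowerSeries in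
theorem factorial_mul_coeff_bernoulliPowerSeries_pow_mul (m : ℕ) (x : ℚ) :
    (m.factorial : ℚ) * coeff m (bernoulliPowerSeries ℚ ^ (m + 1) * rescale x (exp ℚ)) =
      ∏ j ∈ Finset.Icc 1 m, (x - (j : ℚ)) := by
  induction m with
  | zero =>
    have h : constantCoeff (rescale x (exp ℚ)) = 1 := by
      rw [← coeff_zero_eq_constantCoeff_apply, coeff_rescale]
      simp
    simp [bernoulliPowerSeries, h]
  | succ m ih =>
    have h := congrArg (coeff (m + 1))
      (X_mul_derivative_bernoulliPowerSeries_pow_mul (m + 1) x)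
    rw [coeff_succ_X_mul, coeff_derivative, map_sub, map_add, coeff_C_mul, coeff_C_mul,
      coeff_C_mul, coeff_succ_X_mul] at h
    rw [Finset.prod_Icc_succ_top (by lia), ← ih, Nat.factorial_succ]
    push_cast at h ⊢
    linear_combination (m.factorial : ℚ) * h

theorem stmt_17 (m : ℕ) (hm : 1 ≤ m) :
    ∀ x : ℚ, genBernoulliAt (m + 1) m (x / ((m : ℚ) + 1)) =
      ∏ j ∈ Finset.Icc 1 m, (x - (j : ℚ)) := by
  intro x
  have hx : ((m + 1 : ℕ) : ℚ) * (x / ((m : ℚ) + 1)) = x := by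
    push_cast
    field_simp
  rw [← factorial_mul_coeff_bernoulliPowerSeries_pow_mul, ← hx, ← PowerSeries.rescale_exp_pow,
    ← mul_pow, hx, ← mk_bernoulli_eval_eq, ← Fin.prod_const,
    PowerSeries.coeff_prod_antidiagonalTuple, genBernoulliAt, Finset.mul_sum]
  refine Finset.sum_congr rfl fun k _ => ?_
  simp only [PowerSeries.coeff_mk, Finset.prod_div_distrib]
  ring
end

section
/- Let a ≥ 2 be an integer and n ∈ ℕ. Then the series ∑_{k=0}^∞ (k!)^{a−1}·((n+1)!)^a/((n+k+1)!)^a converges and its sum is at most e = exp(1). -/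
theorem factorial_pow_mul_div_le (a n k : ℕ) (ha : 1 ≤ a) :
    (Nat.factorial k : ℝ) ^ (a - 1) * (Nat.factorial (n + 1) : ℝ) ^ a /
      (Nat.factorial (n + k + 1) : ℝ) ^ a ≤ 1 / (Nat.factorial k : ℝ) := by
  have hk : (0 : ℝ) < Nat.factorial k := by exact_mod_cast k.factorial_pos
  have hnk : (0 : ℝ) < Nat.factorial (n + k + 1) := by
    exact_mod_cast (n + k + 1).factorial_pos
  have hle : (Nat.factorial k : ℝ) * Nat.factorial (n + 1) ≤ Nat.factorial (n + k + 1) := by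
    have h := Nat.le_of_dvd (Nat.factorial_pos _)
      (Nat.factorial_mul_factorial_dvd_factorial_add k (n + 1))
    rw [show k + (n + 1) = n + k + 1 by ring] at h
    exact_mod_cast h
  obtain ⟨b, rfl⟩ := Nat.exists_eq_add_of_le' ha
  rw [div_le_div_iff₀ (by positivity) hk, Nat.add_sub_cancel, one_mul]
  calc _ = ((Nat.factorial k : ℝ) * Nat.factorial (n + 1)) ^ (b + 1) := by ring
    _ ≤ _ := by gcongr

theorem stmt_18 (a n : ℕ) (ha : 2 ≤ a) :
    Summable (fun k : ℕ =>
      (Nat.factorial k : ℝ) ^ (a - 1) * (Nat.factorial (n + 1) : ℝ) ^ a /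
        (Nat.factorial (n + k + 1) : ℝ) ^ a) ∧
    (∑' k : ℕ,
      (Nat.factorial k : ℝ) ^ (a - 1) * (Nat.factorial (n + 1) : ℝ) ^ a /
        (Nat.factorial (n + k + 1) : ℝ) ^ a) ≤ Real.exp 1 := by
  have hexp : HasSum (fun k : ℕ => 1 / (Nat.factorial k : ℝ)) (Real.exp 1) := by
    simpa [Real.exp_eq_exp_ℝ] using NormedSpace.expSeries_div_hasSum_exp (1 : ℝ)
  have hle (k : ℕ) := factorial_pow_mul_div_le a n k (by omega)
  have hs := Summable.of_nonneg_of_le (fun k => by positivity) hle hexp.summable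
  exact ⟨hs, hasSum_le hle hs.hasSum hexp⟩
end
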